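/- arXiv:1306.5572 — 3 statements merged into one kernel-verified Lean document; each statement's English description precedes it below -/
import Mathlib

section
/- Let (X, X̂, X̃) be a compactification pack, let d be a metric on X̃ inducing its topology, let k = sup_{z ∈ X̃} d(z, X), and let E ⊆ X̂ × X̂. Then E belongs to the C₀ coarse structure ℰ₀ on X̂ if and only if there exists a function φ : (0,k] → (0,∞) with lim_{t→0⁺} φ(t) = 0 such that E ⊆ {(x,y) ∈ X̂ × X̂ : d(x,y) < φ(min(d(x,X), d(y,X)))}. -/
open Set Metric Topology Filter

/-- `Δ(α) = ⋃_{U ∈ α} U × U`. -/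
def deltaFam {Z : Type*} (α : Set (Set Z)) : Set (Z × Z) := ⋃ U ∈ α, U ×ˢ U

/-- `E(A) = {y : ∃ x ∈ A, (y, x) ∈ E}`. -/
def eApply {Z : Type*} (E : Set (Z × Z)) (A : Set Z) : Set Z := {y | ∃ x ∈ A, (y, x) ∈ E}

/-- `E⁻¹ = {(y,x) : (x,y) ∈ E}`. -/
def invRel {Z : Type*} (E : Set (Z × Z)) : Set (Z × Z) := {p | (p.2, p.1) ∈ E}

/-- `α(A) = ⋃ {U ∈ α : U ∩ A ≠ ∅}`. -/
def famApply {Z : Type*} (α : Set (Set Z)) (A : Set Z) : Set Z :=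
  ⋃₀ {U ∈ α | (U ∩ A).Nonempty}

/-- `β ≺ α`: every member of `β` is contained in some member of `α`. -/
def Refines {Z : Type*} (β α : Set (Set Z)) : Prop := ∀ V ∈ β, ∃ U ∈ α, V ⊆ U

/-- `mult α ≤ m`: every finite subfamily of `α` with nonempty intersection has
cardinality at most `m`. -/
def MultLE {Z : Type*} (α : Set (Set Z)) (m : ℕ) : Prop :=
  ∀ S : Finset (Set Z), ↑S ⊆ α → (⋂₀ (S : Set (Set Z))).Nonempty → S.card ≤ m

/-- A family `α` is locally finite in `hX`:every point of `hX` has a neighborhood meeting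
only finitely many members of `α`. -/
def LocallyFiniteIn {Z : Type*} [TopologicalSpace Z] (hX : Set Z) (α : Set (Set Z)) : Prop :=
  ∀ x ∈ hX, ∃ V : Set Z, IsOpen V ∧ x ∈ V ∧ {U ∈ α | (U ∩ V).Nonempty}.Finite

/-- Covering dimension at most `n` (an integer; the empty space has dimension `-1`);
for `n ≥ 0` this is the usual condition that every finite open cover admits a finite
open refinement, still covering, of multiplicity at most `n + 1`. -/
def DimLE (Y : Type*) [TopologicalSpace Y] (n : ℤ) : Prop :=
  (IsEmpty Y ∧ -1 ≤ n) ∨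
  ∃ m : ℕ, (m : ℤ) = n ∧
    ∀ α : Set (Set Y), α.Finite → (∀ U ∈ α, IsOpen U) → ⋃₀ α = univ →
      ∃ β : Set (Set Y), β.Finite ∧ (∀ V ∈ β, IsOpen V) ∧ ⋃₀ β = univ ∧
        Refines β α ∧ MultLE β (m + 1)

/-- `E` belongs to the C₀ coarse structure on `hX` (with the metric of the ambient
space): for every `ε > 0` there is a compact `K ⊆ hX` with `dist x y < ε` for every
`(x, y) ∈ E \ (K × K)`. -/
def MemC0 {T : Type*} [MetricSpace T] (hX : Set T) (E : Set (T × T)) : Prop :=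
  E ⊆ hX ×ˢ hX ∧
  ∀ ε > 0, ∃ K : Set T, K ⊆ hX ∧ IsCompact K ∧
    ∀ p ∈ E \ K ×ˢ K, dist p.1 p.2 < ε

/-- A family of subsets of `hX` is uniform if `Δ(α) ∈ ℰ₀`. -/
def IsUniformFam {T : Type*} [MetricSpace T] (hX : Set T) (α : Set (Set T)) : Prop :=
  MemC0 hX (deltaFam α)

/-- A uniform cover of `hX`. -/
def IsUniformCover {T : Type*} [MetricSpace T] (hX : Set T) (α : Set (Set T)) : Prop :=
  IsUniformFam hX α ∧ ⋃₀ α = hX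

/-- A canonical cover of the compactification pack `(X, Xᶜ, T)`: an open, locally
finite cover `α` of `X̂ = Xᶜ` such that for every `x ∈ X` and every neighborhood `V`
of `x` there is a neighborhood `W` of `x` with `α(W ∩ X̂) ⊆ V`. -/
def IsCanonicalCover {T : Type*} [TopologicalSpace T] (X : Set T) (α : Set (Set T)) : Prop :=
  (∀ U ∈ α, IsOpen U ∧ U ⊆ Xᶜ) ∧ ⋃₀ α = Xᶜ ∧ LocallyFiniteIn Xᶜ α ∧
  ∀ x ∈ X, ∀ V ∈ 𝓝 x, ∃ W ∈ 𝓝 x, famApply α (W ∩ Xᶜ) ⊆ V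

/-- `asdim (hX, ℰ₀) ≤ m`: every uniform cover admits a uniform coarsening of
multiplicity at most `m + 1`. -/
def AsdimLE {T : Type*} [MetricSpace T] (hX : Set T) (m : ℕ) : Prop :=
  ∀ β, IsUniformCover hX β → ∃ α, IsUniformCover hX α ∧ Refines β α ∧ MultLE α (m + 1)

/-- `X` is a cylindrical subset of `T`. -/
def IsCylindrical (T : Type*) [TopologicalSpace T] (X : Set T) : Prop :=
  ∃ j : X × unitInterval → T, Topology.IsEmbedding j ∧ ∀ x : X, j (x, 0) = (x : T)

/-- `X` is a Z-set of the metric space `T`. -/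
def IsZSet {T : Type*} [MetricSpace T] (X : Set T) : Prop :=
  IsClosed X ∧ ∀ ε > 0, ∃ f : T → T, Continuous f ∧ (∀ z, dist (f z) z < ε) ∧
    Set.range f ∩ X = ∅

/-- `E ∈ ℰ₀` iff `E` is contained in
`{(x,y) : d(x,y) < φ(min(d(x,X), d(y,X)))}` for some `φ : (0,k] → (0,∞)` with
`φ(t) → 0` as `t → 0⁺`, where `k = sup_z d(z, X)`. -/
theorem statement15 {T : Type*} [MetricSpace T] [CompactSpace T]
    (X : Set T) (hXcl : IsClosed X) (hXnd : IsNowhereDense X)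
    (k : ℝ) (hk : k = ⨆ z : T, infDist z X)
    (E : Set (T × T)) (hE : E ⊆ Xᶜ ×ˢ Xᶜ) :
    MemC0 Xᶜ E ↔
      ∃ φ : ℝ → ℝ, (∀ t ∈ Set.Ioc 0 k, 0 < φ t) ∧
        Filter.Tendsto φ (𝓝[>] (0 : ℝ)) (𝓝 0) ∧
        E ⊆ {p : T × T | dist p.1 p.2 < φ (min (infDist p.1 X) (infDist p.2 X))} := by
  constructor
  · rintro ⟨-, h⟩
    set m : T × T → ℝ := fun p => min (infDist p.1 X) (infDist p.2 X) with hm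
    set S : ℝ → Set ℝ := fun t => (fun p : T × T => dist p.1 p.2) '' {p ∈ E | m p = t} with hS
    have hbdd (t : ℝ) : BddAbove (S t) := by
      refine ⟨diam (univ : Set T), ?_⟩
      rintro _ ⟨p, -, rfl⟩
      exact dist_le_diam_of_mem isCompact_univ.isBounded (mem_univ _) (mem_univ _)
    have hnonneg (t : ℝ) : 0 ≤ sSup (S t) := by
      refine Real.sSup_nonneg ?_
      rintro _ ⟨p, -, rfl⟩
      exact dist_nonneg
    have hpos (t : ℝ) : 0 < if t ≤ 0 then (1 : ℝ) else t := by
      split_ifs with ht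
      · exact one_pos
      · exact not_le.1 ht
    refine ⟨fun t => (if t ≤ 0 then 1 else t) + sSup (S t),
      fun t _ => add_pos_of_pos_of_nonneg (hpos t) (hnonneg t), ?_, ?_⟩
    · rw [Metric.tendsto_nhdsWithin_nhds]
      intro ε hε
      obtain ⟨K, hKX, hK, hKE⟩ := h (ε / 2) (half_pos hε)
      obtain ⟨δ, hδ, hdisj⟩ :=
        (disjoint_compl_left.mono_left hKX : Disjoint K X).exists_thickenings hK hXcl
      refine ⟨min δ (ε / 2), lt_min hδ (half_pos hε), fun t ht htd => ?_⟩
      have ht0 : 0 < t := ht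
      rw [Real.dist_eq, sub_zero, abs_of_pos ht0, lt_min_iff] at htd
      have hsup : sSup (S t) ≤ ε / 2 := by
        refine Real.sSup_le ?_ (half_pos hε).le
        rintro _ ⟨p, ⟨hpE, hpt⟩, rfl⟩
        have hXne : X.Nonempty := by
          by_contra hX
          rw [not_nonempty_iff_eq_empty] at hX
          simp only [hm, hX, infDist_empty, min_self] at hpt
          exact ht0.ne hpt
        have hfar {z : T} (hz : z ∈ K) : δ ≤ infDist z X := by
          by_contra! hlt
          exact disjoint_left.1 hdisj (self_subset_thickening hδ K hz)
            ((mem_thickening_iff_infDist_lt hXne).2 hlt)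
        refine (hKE p ⟨hpE, fun hpK => ?_⟩).le
        exact (hpt ▸ htd.1).not_ge (le_min (hfar hpK.1) (hfar hpK.2))
      rw [Real.dist_eq, sub_zero, if_neg ht0.not_ge,
        abs_of_pos (add_pos_of_pos_of_nonneg ht0 (hnonneg t))]
      linarith
    · intro p hp
      have hle : dist p.1 p.2 ≤ sSup (S (m p)) := le_csSup (hbdd _) ⟨p, ⟨hp, rfl⟩, rfl⟩
      exact hle.trans_lt (lt_add_of_pos_left _ (hpos _))
  · rintro ⟨φ, -, hφ, hEφ⟩
    refine ⟨hE, fun ε hε => ?_⟩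
    rcases X.eq_empty_or_nonempty with rfl | hXne
    · exact ⟨univ, by simp, isCompact_univ, fun p hp => absurd ⟨mem_univ _, mem_univ _⟩ hp.2⟩
    obtain ⟨δ, hδ, hφδ⟩ := Metric.tendsto_nhdsWithin_nhds.1 hφ ε hε
    refine ⟨{x | δ ≤ infDist x X}, fun x hx hxX => ?_,
      (isClosed_le continuous_const (continuous_infDist_pt X)).isCompact, ?_⟩
    · rw [mem_ofPred_eq, infDist_zero_of_mem hxX] at hx
      exact hx.not_gt hδ
    · rintro p ⟨hpE, hpK⟩
      have hpos : 0 < min (infDist p.1 X) (infDist p.2 X) :=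
        lt_min ((hXcl.notMem_iff_infDist_pos hXne).1 (hE hpE).1)
          ((hXcl.notMem_iff_infDist_pos hXne).1 (hE hpE).2)
      have hlt : min (infDist p.1 X) (infDist p.2 X) < δ := by
        by_contra! hge
        exact hpK ⟨hge.trans (min_le_left _ _), hge.trans (min_le_right _ _)⟩
      have hφp := hφδ hpos (by rwa [Real.dist_eq, sub_zero, abs_of_pos hpos])
      rw [Real.dist_eq, sub_zero] at hφp
      exact (hEφ hpE).trans ((le_abs_self _).trans_lt hφp)
end

section
/- Let (X, X̂, X̃) be a metrizable compactification pack, let d be a metric on X̃ inducing its topology, let k = sup_{z ∈ X̃} d(z, X), and let λ : (0,k] → (0,∞) be an increasing continuous function with lim_{t→0⁺} λ(t) = 0. Define h : (0,∞) → (0,k] by h(t) = sup_{x ∈ X} d(x, X̃ \ B(X,t)) for t ≤ k and h(t) = k for t ≥ k, where B(X,t) = {z ∈ X̃ : d(z,X) < t}; define φ : (0,k] → (0,∞) by φ(t) = h(t) + λ(t) + h(t + λ(t)); and set E_{d,λ} = {(x,y) ∈ X̂ × X̂ : d(x,y) < φ(min(d(x,X), d(y,X)))}. Then E_{d,λ}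 belongs to the C₀ coarse structure ℰ₀ on X̂, and for every uniform cover α of X̂ and every n ∈ ℕ, if mult_{E_{d,λ}} α ≤ n + 1 then dim X ≤ n − 1 (i.e. mult_{E_{d,λ}} α ≥ dim X + 2). -/
open Set Metric Topology Filter

theorem dense_setOf_sum_smul_add_eq_zero_imp {ι Q W : Type*} [Fintype ι]
    [NormedAddCommGroup W] [NormedSpace ℝ W] [FiniteDimensional ℝ W]
    [NormedAddCommGroup Q] [NormedSpace ℝ Q] [FiniteDimensional ℝ Q]
    (K : ι → Q → W) (hK : ∀ i, ContDiff ℝ 1 (K i)) (d : ℕ)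
    (hd : d + Module.finrank ℝ Q < Module.finrank ℝ W) :
    Dense {w : ι → W | ∀ (y : Q) (q : ι → ℝ), {i | q i ≠ 0}.ncard ≤ d + 1 →
      ∑ i, q i • (w i + K i y) = 0 → q = 0} := by
  classical
  cases isEmpty_or_nonempty ι
  · convert dense_univ
    exact eq_univ_of_forall fun _ _ q _ _ => Subsingleton.elim q 0
  let f : (i₀ : ι) → (J : Finset {i // i ≠ i₀}) →
      (J → ℝ) × Q × ({i // i ≠ i₀} → W) → ι → W := fun i₀ J p i =>
    if h : i = i₀ then -K i₀ p.2.1 - ∑ j : J, p.1 j • (p.2.2 j + K j p.2.1) else p.2.2 ⟨i, h⟩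
  have hf : ∀ i₀ J, ContDiff ℝ 1 (f i₀ J) := by
    intro i₀ J
    rw [contDiff_pi]
    intro i
    by_cases h : i = i₀
    · simp only [f, h, dite_true]
      refine ((hK _).comp contDiff_snd.fst).neg.sub (ContDiff.sum fun j _ => ?_)
      refine ContDiff.smul ?_ (ContDiff.add ?_ ((hK _).comp contDiff_snd.fst))
      · exact (contDiff_apply ℝ ℝ j).comp contDiff_fst
      · exact (contDiff_apply ℝ W (j : {i // i ≠ i₀})).comp contDiff_snd.snd
    · simp only [f, h, dite_false]
      exact (contDiff_apply ℝ W (⟨i, h⟩ : {i // i ≠ i₀})).comp contDiff_snd.snd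
  let I := {p : Σ i₀ : ι, Finset {i // i ≠ i₀} // p.2.card ≤ d}
  have hdim : dimH (⋃ p : I, range (f p.1.1 p.1.2)) < Module.finrank ℝ (ι → W) := by
    have hle : dimH (⋃ p : I, range (f p.1.1 p.1.2)) ≤
        ((Module.finrank ℝ (ι → W) - 1 : ℕ) : ENNReal) := by
      rw [dimH_iUnion]
      refine iSup_le fun p => (hf p.1.1 p.1.2).dimH_range_le.trans ?_
      have hp := p.2
      have hc := Fintype.card_pos_iff.mpr ⟨p.1.1⟩
      have hcard : Fintype.card {i // i ≠ p.1.1} = Fintype.card ι - 1 := by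
        simp
      obtain ⟨c, hc'⟩ : ∃ c, Fintype.card ι = c + 1 := ⟨_, (Nat.succ_pred_eq_of_pos hc).symm⟩
      norm_cast
      simp only [Module.finrank_prod, Module.finrank_pi_fintype, Module.finrank_self,
        Finset.sum_const, Finset.card_univ, Fintype.card_coe, smul_eq_mul, hcard, hc', mul_one,
        Nat.add_sub_cancel, Nat.add_mul, one_mul]
      omega
    refine hle.trans_lt ?_
    norm_cast
    have : 0 < Module.finrank ℝ (ι → W) := by
      simp only [Module.finrank_pi_fintype, Finset.sum_const, Finset.card_univ, smul_eq_mul]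
      exact Nat.mul_pos Fintype.card_pos (by omega)
    omega
  refine (dense_compl_of_dimH_lt_finrank hdim).mono ?_
  intro w hw y q hq hsum
  by_contra hq0
  obtain ⟨i₀, hi₀⟩ := Function.ne_iff.mp hq0
  simp only [Pi.zero_apply] at hi₀
  apply hw
  let J : Finset {i // i ≠ i₀} := Finset.univ.filter fun i => q i ≠ 0
  have hJ : J.card ≤ d := by
    have h1 : (J.map (Function.Embedding.subtype _)) ⊆
        (Finset.univ.filter fun i => q i ≠ 0).erase i₀ := by
      intro i hi
      simp [J] at hi ⊢
      tauto
    have h2 := Finset.card_le_card h1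
    rw [Finset.card_map, Finset.card_erase_of_mem (by simpa using hi₀)] at h2
    rw [Set.ncard_eq_toFinset_card', Set.toFinset_ofPred] at hq
    omega
  refine mem_iUnion.mpr ⟨⟨⟨i₀, J⟩, hJ⟩, ⟨fun j => q j / q i₀, y, fun i => w i⟩, ?_⟩
  funext i
  by_cases h : i = i₀
  · subst h
    simp only [f, dite_true]
    have h3 : ∑ j : J, (q j / q i) • (w j + K j y) =
        (q i)⁻¹ • ∑ j ∈ Finset.univ.erase i, q j • (w j + K j y) := by
      rw [Finset.smul_sum, Finset.sum_coe_sort J (fun j => (q j / q i) • (w j + K j y)),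
        Finset.sum_filter_of_ne, Finset.sum_subtype (p := fun j => j ≠ i) _ (by simp)]
      · refine Finset.sum_congr rfl fun j _ => ?_
        rw [smul_smul, div_eq_inv_mul]
      · intro j _ hj h0
        simp [h0] at hj
    have h4 := Finset.add_sum_erase Finset.univ (fun j => q j • (w j + K j y)) (Finset.mem_univ i)
    rw [hsum] at h4
    rw [h3, ← neg_eq_of_add_eq_zero_right h4, smul_neg, smul_smul, inv_mul_cancel₀ hi₀]
    simp
  · simp [f, h]

/-- Partitions of unity of arbitrarily small mesh, at most `n + 1` of whose members are nonzero at
each point. -/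
def HasFinePartitions.{u} (Y : Type u) [PseudoMetricSpace Y] (n : ℕ) : Prop :=
  ∀ δ > (0 : ℝ), ∃ (ι : Type u) (_ : Fintype ι) (g : ι → Y → ℝ),
    (∀ i, Continuous (g i)) ∧ (∀ i y, 0 ≤ g i y) ∧ (∀ y, ∑ i, g i y = 1) ∧
    (∀ y, {i | g i y ≠ 0}.ncard ≤ n + 1) ∧
    ∀ i y z, g i y ≠ 0 → g i z ≠ 0 → dist y z < δ

/-- A discrete substitute for `dim (Y × [0, 1]) ≤ n`: sequences of partitions of unity of
arbitrarily small mesh in which two consecutive partitions together have at most `n + 1` members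
that are nonzero at a given point. The sign `s` tells the initial indices from the final ones. -/
def HasFineCylinders.{u} (Y : Type u) [PseudoMetricSpace Y] (n : ℕ) : Prop :=
  ∀ δ > (0 : ℝ), ∃ (ι : Type u) (_ : Fintype ι) (m : ℕ) (p : ℕ → ι → Y → ℝ) (s : ι → ℝ),
    (∀ l i, Continuous (p l i)) ∧ (∀ l i y, 0 ≤ p l i y) ∧ (∀ l y, ∑ i, p l i y = 1) ∧
    (∀ l y, {i | p l i y ≠ 0 ∨ p (l + 1) i y ≠ 0}.ncard ≤ n + 1) ∧
    (∀ i k l y z, p k i y ≠ 0 → p l i z ≠ 0 → dist y z < δ) ∧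
    (∀ i, |s i| ≤ 1) ∧ (∀ i y, p 0 i y ≠ 0 → s i = 1) ∧ (∀ i y, p m i y ≠ 0 → s i = -1)

theorem HasFineCylinders.hasFinePartitions {Y : Type*} [PseudoMetricSpace Y] {n : ℕ}
    (h : HasFineCylinders Y n) : HasFinePartitions Y n := by
  intro δ hδ
  obtain ⟨ι, _, m, p, s, hp, hp0, hp1, hmult, hmesh, -⟩ := h δ hδ
  refine ⟨ι, ‹_›, p 0, hp 0, hp0 0, hp1 0, fun y => ?_, fun i y z => hmesh i 0 0 y z⟩
  exact (ncard_le_ncard (fun i hi => Or.inl hi) (toFinite _)).trans (hmult 0 y)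

/-- For `s = 1` and `s = -1` these are the lifts of `v` to the two hemispheres, up to scaling. -/
noncomputable def poleLift {V : Type*} [NormedAddCommGroup V] [NormedSpace ℝ V] (s : ℝ) (v : V) :
    V × ℝ :=
  ((2 : ℝ) • v, s * (1 - ‖v‖ ^ 2))

theorem continuous_poleLift {V : Type*} [NormedAddCommGroup V] [NormedSpace ℝ V] (s : ℝ) :
    Continuous (poleLift s : V → V × ℝ) := by
  unfold poleLift
  fun_prop

theorem norm_poleLift_sub_le {V : Type*} [NormedAddCommGroup V] [NormedSpace ℝ V] {s : ℝ}
    (hs : |s| ≤ 1) {v w : V} (hv : ‖v‖ ≤ 1) (hw : ‖w‖ ≤ 1) :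
    ‖poleLift s v - poleLift s w‖ ≤ 2 * ‖v - w‖ := by
  unfold poleLift
  rw [Prod.mk_sub_mk, Prod.norm_def]
  refine max_le ?_ ?_
  · rw [← smul_sub, norm_smul]; simp
  · have h1 : s * (1 - ‖v‖ ^ 2) - s * (1 - ‖w‖ ^ 2) = s * ((‖w‖ - ‖v‖) * (‖v‖ + ‖w‖)) := by ring
    simp only
    rw [h1, Real.norm_eq_abs, abs_mul, abs_mul]
    have h2 := abs_norm_sub_norm_le w v
    rw [norm_sub_rev] at h2
    have h3 : |‖v‖ + ‖w‖| ≤ 2 := by rw [abs_of_nonneg (by positivity)]; linarith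
    calc |s| * (|‖w‖ - ‖v‖| * |‖v‖ + ‖w‖|) ≤ 1 * (‖v - w‖ * 2) := by gcongr
      _ = _ := by ring

/-- A discrete homotopy through nowhere vanishing maps between the two pole lifts of `e`, constant
where `e` has norm one. -/
def HasPoleChain {Y V : Type*} [TopologicalSpace Y] [NormedAddCommGroup V] [NormedSpace ℝ V]
    (e : Y → V) : Prop :=
  ∃ (m : ℕ) (G : ℕ → Y → V × ℝ), (∀ l, Continuous (G l)) ∧
    (∀ y, G 0 y = poleLift 1 (e y)) ∧ (∀ y, G m y = poleLift (-1) (e y)) ∧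
    (∀ l y, ‖e y‖ = 1 → G l y = ((2 : ℝ) • e y, 0)) ∧
    ∀ l < m, ∀ y, (0 : V × ℝ) ∉ segment ℝ (G l y) (G (l + 1) y)

theorem zero_notMem_segment_of_mem_ball {E : Type*} [NormedAddCommGroup E] [NormedSpace ℝ E]
    {a b c : E} (ha : a ∈ ball c ‖c‖) (hb : b ∈ ball c ‖c‖) : (0 : E) ∉ segment ℝ a b := by
  intro h
  have := (convex_ball c ‖c‖).segment_subset ha hb h
  simp [dist_eq_norm] at this

theorem HasFineCylinders.hasPoleChain {Y V : Type*} [PseudoMetricSpace Y] [CompactSpace Y]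
    [NormedAddCommGroup V] [NormedSpace ℝ V] [FiniteDimensional ℝ V] {n : ℕ}
    (h : HasFineCylinders Y n) (hV : Module.finrank ℝ V = n) {e : Y → V} (he : Continuous e)
    (he1 : ∀ y, ‖e y‖ ≤ 1) : HasPoleChain e := by
  classical
  obtain ⟨δ, hδ, hδe⟩ := Metric.uniformContinuous_iff.mp
    (CompactSpace.uniformContinuous_of_continuous he) (1 / 16) (by norm_num)
  obtain ⟨ι, _, m, p, s, hp, hp0, hp1, hmult, hmesh, hs, hs0, hsm⟩ := h δ hδ
  have hbase : ∀ i, ∃ v : V, ‖v‖ ≤ 1 ∧ ∀ l y, p l i y ≠ 0 → ‖v - e y‖ < 1 / 16 := by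
    intro i
    by_cases hi : ∃ l y, p l i y ≠ 0
    · obtain ⟨l, y, hy⟩ := hi
      refine ⟨e y, he1 y, fun l' z hz => ?_⟩
      rw [← dist_eq_norm]
      exact hδe (hmesh i l l' y z hy hz)
    · push Not at hi
      exact ⟨0, by simp, fun l y hy => (hy (hi l y)).elim⟩
  choose v hv1 hv using hbase
  have hdense := dense_setOf_sum_smul_add_eq_zero_imp (ι := ι) (Q := Fin 0 → ℝ) (W := V × ℝ)
    (fun _ _ => 0) (fun _ => contDiff_const) n (by simp [hV])
  obtain ⟨w, hw, hwv⟩ := Metric.dense_iff.mp hdense (fun i => poleLift (s i) (v i)) (1 / 16)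
    (by norm_num)
  have hwv' : ∀ i, ‖w i - poleLift (s i) (v i)‖ < 1 / 16 := by
    intro i
    rw [← dist_eq_norm]
    exact (dist_le_pi_dist w _ i).trans_lt hw
  have hgen : ∀ q : ι → ℝ, {i | q i ≠ 0}.ncard ≤ n + 1 → ∑ i, q i • w i = 0 → q = 0 := by
    intro q h1 h2
    exact hwv 0 q h1 (by simpa using h2)
  have hnear : ∀ l i y, p l i y ≠ 0 → ‖w i - poleLift (s i) (e y)‖ < 3 / 16 := by
    intro l i y hy
    have h1 := norm_poleLift_sub_le (hs i) (hv1 i) (he1 y)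
    have h2 := hv i l y hy
    have h3 := hwv' i
    have h4 := norm_sub_le_norm_sub_add_norm_sub (w i) (poleLift (s i) (v i)) (poleLift (s i) (e y))
    linarith
  let G' : ℕ → Y → V × ℝ := fun l y => ∑ i, p l i y • w i
  let μ : Y → ℝ := fun y => max 0 (4 * ‖e y‖ - 3)
  have hμ0 : ∀ y, 0 ≤ μ y := fun y => le_max_left _ _
  have hμ1 : ∀ y, μ y ≤ 1 := fun y => max_le zero_le_one (by linarith [he1 y])
  let G₀ : ℕ → Y → V × ℝ := fun l y => (1 - μ y) • G' l y + μ y • ((2 : ℝ) • e y, (0 : ℝ))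
  have hG₀c : ∀ l, Continuous (G₀ l) := by
    intro l
    have := hp l
    have : Continuous μ := by fun_prop
    fun_prop
  have hG'mem : ∀ l y (S : Set (V × ℝ)), Convex ℝ S → (∀ i, p l i y ≠ 0 → w i ∈ S) →
      G' l y ∈ S := by
    intro l y S hS hi
    simp only [G', ← finsum_eq_sum_of_fintype]
    exact hS.finsum_mem (fun i => hp0 l i y) (by rw [finsum_eq_sum_of_fintype, hp1]) hi
  have hball : ∀ y, 3 / 4 < ‖e y‖ → ∀ σ : ℝ, |σ| ≤ 1 →
      ‖poleLift σ (e y) - ((2 : ℝ) • e y, (0 : ℝ))‖ ≤ 7 / 16 := by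
    intro y hy σ hσ
    have h1 : 0 ≤ 1 - ‖e y‖ ^ 2 := by nlinarith [he1 y, norm_nonneg (e y)]
    have h2 : 1 - ‖e y‖ ^ 2 ≤ 7 / 16 := by nlinarith
    rw [poleLift, Prod.mk_sub_mk, sub_self, sub_zero, Prod.norm_def]
    refine max_le (by norm_num) ?_
    rw [Real.norm_eq_abs, abs_mul, abs_of_nonneg h1]
    nlinarith
  have hnorm : ∀ y, ‖(((2 : ℝ) • e y, (0 : ℝ)) : V × ℝ)‖ = 2 * ‖e y‖ := by
    intro y
    simp [Prod.norm_def, norm_smul]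
  have hG₀ball : ∀ l y, 3 / 4 < ‖e y‖ →
      G₀ l y ∈ ball (((2 : ℝ) • e y, (0 : ℝ)) : V × ℝ) ‖(((2 : ℝ) • e y, (0 : ℝ)) : V × ℝ)‖ := by
    intro l y hy
    have hpos : 0 < ‖(((2 : ℝ) • e y, (0 : ℝ)) : V × ℝ)‖ := by rw [hnorm]; linarith
    refine convex_ball _ _ (hG'mem l y _ (convex_ball _ _) fun i hi => ?_) (mem_ball_self hpos)
      (by linarith [hμ1 y]) (hμ0 y) (by ring)
    rw [mem_ball, dist_eq_norm, hnorm]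
    have h1 := norm_sub_le_norm_sub_add_norm_sub (w i) (poleLift (s i) (e y))
      ((2 : ℝ) • e y, (0 : ℝ))
    linarith [hnear l i y hi, hball y hy (s i) (hs i)]
  have hG₀eq : ∀ l y, ‖e y‖ ≤ 3 / 4 → G₀ l y = G' l y := by
    intro l y hy
    have : μ y = 0 := max_eq_left (by linarith)
    simp [G₀, this]
  have hend : ∀ l y (σ : ℝ), |σ| = 1 → (∀ i, p l i y ≠ 0 → s i = σ) →
      (0 : V × ℝ) ∉ segment ℝ (poleLift σ (e y)) (G₀ l y) := by
    intro l y σ hσ hsσ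
    rcases lt_or_ge (3 / 4) ‖e y‖ with hy | hy
    · refine zero_notMem_segment_of_mem_ball ?_ (hG₀ball l y hy)
      rw [mem_ball, dist_eq_norm, hnorm]
      linarith [hball y hy σ hσ.le]
    · have hlow : 7 / 16 ≤ ‖poleLift σ (e y)‖ := by
        have h1 : 7 / 16 ≤ 1 - ‖e y‖ ^ 2 := by nlinarith [norm_nonneg (e y)]
        refine le_trans ?_ (norm_snd_le _)
        rw [poleLift, Real.norm_eq_abs, abs_mul, hσ, one_mul]
        exact h1.trans (le_abs_self _)
      refine zero_notMem_segment_of_mem_ball (mem_ball_self (by linarith)) ?_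
      rw [hG₀eq l y hy]
      refine hG'mem l y _ (convex_ball _ _) fun i hi => ?_
      rw [mem_ball, dist_eq_norm, ← hsσ i hi]
      rw [← hsσ i hi] at hlow
      linarith [hnear l i y hi]
  refine ⟨m + 2, fun l => if l = 0 then fun y => poleLift 1 (e y) else if l ≤ m + 1 then G₀ (l - 1)
    else fun y => poleLift (-1) (e y), ?_, ?_, ?_, ?_, ?_⟩
  · intro l
    dsimp only
    split_ifs
    exacts [(continuous_poleLift _).comp he, hG₀c _, (continuous_poleLift _).comp he]
  · simp
  · simp
  · intro l y hy
    dsimp only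
    split_ifs
    · simp [poleLift, hy]
    · have : μ y = 1 := by simp only [μ, hy]; norm_num
      simp [G₀, this]
    · simp [poleLift, hy]
  · intro l hl y
    rcases Nat.eq_zero_or_pos l with rfl | hl0
    · simpa using hend 0 y 1 (by simp) fun i hi => hs0 i y hi
    rcases Nat.lt_or_ge m l with hlm | hlm
    · obtain rfl : l = m + 1 := by omega
      simp only [Nat.add_eq_zero_iff, one_ne_zero, and_false, if_false, le_refl, if_true,
        Nat.add_sub_cancel, show ¬ (m + 1 + 1 ≤ m + 1) by omega]
      rw [segment_symm]
      exact hend m y (-1) (by simp) fun i hi => hsm i y hi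
    obtain ⟨k, rfl⟩ : ∃ k, l = k + 1 := ⟨l - 1, by omega⟩
    simp only [Nat.add_eq_zero_iff, one_ne_zero, and_false, if_false, Nat.add_sub_cancel,
      show k + 1 ≤ m + 1 by omega, show k + 1 + 1 ≤ m + 1 by omega, if_true]
    rcases lt_or_ge (3 / 4) ‖e y‖ with hy | hy
    · exact zero_notMem_segment_of_mem_ball (hG₀ball _ _ hy) (hG₀ball _ _ hy)
    · rw [hG₀eq _ _ hy, hG₀eq _ _ hy]
      rintro ⟨a, b, ha, hb, hab, h0⟩
      have := hgen (fun i => a * p k i y + b * p (k + 1) i y) ?_ ?_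
      · have h1 : ∑ i, (a * p k i y + b * p (k + 1) i y) = 0 := by
          simpa using congrArg (fun q : ι → ℝ => ∑ i, q i) this
        rw [Finset.sum_add_distrib, ← Finset.mul_sum, ← Finset.mul_sum, hp1, hp1] at h1
        linarith
      · refine (ncard_le_ncard (fun i hi => ?_) (toFinite _)).trans (hmult k y)
        by_contra hc
        simp only [mem_ofPred_eq, not_or, not_not] at hc hi
        exact hi (by simp [hc.1, hc.2])
      · rw [← h0]
        simp only [G', add_smul, Finset.sum_add_distrib, Finset.smul_sum, mul_smul]

/-- Maps of norm at most one can be deformed, relative to the points where the norm is one, to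
nowhere vanishing maps. -/
def HasUnitExtensions (Y V : Type*) [TopologicalSpace Y] [NormedAddCommGroup V] : Prop :=
  ∀ e : Y → V, Continuous e → (∀ y, ‖e y‖ ≤ 1) →
    ∃ u : Y → V, Continuous u ∧ (∀ y, u y ≠ 0) ∧ ∀ y, ‖e y‖ = 1 → u y = e y

section RCLike

variable {𝕜 : Type*} [RCLike 𝕜]

/-- The norm of the traceless Hermitian matrix `!![h, conj z; z, -h]` attached to `g = (z, h)`. -/
noncomputable def pauliNorm (g : 𝕜 × ℝ) : ℝ := √(‖g.1‖ ^ 2 + g.2 ^ 2)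

theorem pauliNorm_sq (g : 𝕜 × ℝ) : pauliNorm g ^ 2 = ‖g.1‖ ^ 2 + g.2 ^ 2 :=
  Real.sq_sqrt (by positivity)

theorem pauliNorm_pos {g : 𝕜 × ℝ} (hg : g ≠ 0) : 0 < pauliNorm g := by
  refine Real.sqrt_pos.mpr ?_
  by_contra! h
  have h1 : ‖g.1‖ = 0 := by nlinarith [sq_nonneg ‖g.1‖, sq_nonneg g.2]
  have h2 : g.2 = 0 := by nlinarith [sq_nonneg ‖g.1‖, sq_nonneg g.2]
  exact hg (Prod.ext (norm_eq_zero.mp h1) h2)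

theorem continuous_pauliNorm : Continuous (pauliNorm : 𝕜 × ℝ → ℝ) := by
  unfold pauliNorm
  fun_prop

/-- The product of the matrix `!![h, conj z; z, -h]` attached to `g = (z, h)` with `v`. -/
noncomputable def pauliMul (g : 𝕜 × ℝ) (v : 𝕜 × 𝕜) : 𝕜 × 𝕜 :=
  ((g.2 : 𝕜) * v.1 + starRingEnd 𝕜 g.1 * v.2, g.1 * v.1 - (g.2 : 𝕜) * v.2)

theorem pauliMul_pauliMul (g : 𝕜 × ℝ) (v : 𝕜 × 𝕜) :
    pauliMul g (pauliMul g v) = ((pauliNorm g ^ 2 : ℝ) : 𝕜) • v := by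
  have h := RCLike.conj_mul g.1
  rw [pauliNorm_sq]
  push_cast
  rw [← h]
  ext <;> simp only [pauliMul, Prod.smul_fst, Prod.smul_snd, smul_eq_mul] <;> ring

theorem pauliMul_add_smul (g : 𝕜 × ℝ) (c : 𝕜) (v w : 𝕜 × 𝕜) :
    pauliMul g (c • v + w) = c • pauliMul g v + pauliMul g w := by
  ext <;> simp only [pauliMul, Prod.fst_add, Prod.snd_add, Prod.smul_fst, Prod.smul_snd,
    smul_eq_mul] <;> ring

theorem smul_add_smul_pauliMul (a b : ℝ) (g g' : 𝕜 × ℝ) (v : 𝕜 × 𝕜) :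
    pauliMul (a • g + b • g') v = (a : 𝕜) • pauliMul g v + (b : 𝕜) • pauliMul g' v := by
  ext <;> simp [pauliMul, RCLike.real_smul_eq_coe_mul] <;> ring

theorem pauliMul_ne_zero {g : 𝕜 × ℝ} (hg : g ≠ 0) {v : 𝕜 × 𝕜} (hv : v ≠ 0) :
    pauliMul g v ≠ 0 := by
  intro h
  have h1 := pauliMul_pauliMul g v
  rw [h] at h1
  have h2 : pauliMul g (0 : 𝕜 × 𝕜) = 0 := by simp [pauliMul]
  rw [h2] at h1
  have h3 : ((pauliNorm g ^ 2 : ℝ) : 𝕜) ≠ 0 :=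
    RCLike.ofReal_ne_zero.mpr (pow_ne_zero _ (pauliNorm_pos hg).ne')
  exact (smul_ne_zero h3 hv) h1.symm

theorem pauliNorm_smul_add_pauliMul_ne_zero {g g' : 𝕜 × ℝ} (h0 : (0 : 𝕜 × ℝ) ∉ segment ℝ g g')
    {v : 𝕜 × 𝕜} (hv : v ≠ 0) (hgv : pauliMul g v = (pauliNorm g : 𝕜) • v) :
    (pauliNorm g' : 𝕜) • v + pauliMul g' v ≠ 0 := by
  intro h
  have hg : g ≠ 0 := fun h => h0 (h ▸ left_mem_segment ℝ g g')
  have hg' : g' ≠ 0 := fun h => h0 (h ▸ right_mem_segment ℝ g g')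
  have hN := pauliNorm_pos hg
  have hN' := pauliNorm_pos hg'
  refine pauliMul_ne_zero (g := pauliNorm g' • g + pauliNorm g • g') ?_ hv ?_
  · intro h1
    refine h0 ⟨pauliNorm g' / (pauliNorm g + pauliNorm g'),
      pauliNorm g / (pauliNorm g + pauliNorm g'), by positivity, by positivity, by field_simp; ring,
      ?_⟩
    rw [div_eq_inv_mul, div_eq_inv_mul, mul_smul, mul_smul, ← smul_add, h1, smul_zero]
  · rw [smul_add_smul_pauliMul, hgv, eq_neg_of_add_eq_zero_right h, smul_neg, smul_comm,
      add_neg_cancel]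

variable {Y : Type*} [TopologicalSpace Y]

theorem exists_continuous_pauliMul_eq {G : ℕ → Y → 𝕜 × ℝ} (hG : ∀ l, Continuous (G l))
    {a : Y → 𝕜 × 𝕜} (hac : Continuous a) (ha0 : ∀ y, a y ≠ 0)
    (haG : ∀ y, pauliMul (G 0 y) (a y) = (pauliNorm (G 0 y) : 𝕜) • a y) (m : ℕ)
    (h0 : ∀ l < m, ∀ y, (0 : 𝕜 × ℝ) ∉ segment ℝ (G l y) (G (l + 1) y)) :
    ∃ v : Y → 𝕜 × 𝕜, Continuous v ∧ (∀ y, v y ≠ 0) ∧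
      (∀ y, pauliMul (G m y) (v y) = (pauliNorm (G m y) : 𝕜) • v y) ∧
      ∀ y, (∀ l, G l y = G 0 y) → ∃ c : ℝ, 0 < c ∧ v y = (c : 𝕜) • a y := by
  induction m with
  | zero => exact ⟨a, hac, ha0, haG, fun y _ => ⟨1, one_pos, by simp⟩⟩
  | succ m ih =>
    obtain ⟨v, hvc, hv0, hvG, hva⟩ := ih fun l hl => h0 l (by omega)
    refine ⟨fun y => (pauliNorm (G (m + 1) y) : 𝕜) • v y + pauliMul (G (m + 1) y) (v y), ?_,
      fun y => pauliNorm_smul_add_pauliMul_ne_zero (h0 m (by omega) y) (hv0 y) (hvG y), ?_, ?_⟩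
    · have hG' := hG (m + 1)
      have h1 : Continuous fun y => (pauliNorm (G (m + 1) y) : 𝕜) :=
        RCLike.continuous_ofReal.comp (continuous_pauliNorm.comp hG')
      have h2 : Continuous fun y => ((G (m + 1) y).2 : 𝕜) :=
        RCLike.continuous_ofReal.comp hG'.snd
      have h3 : Continuous fun y => starRingEnd 𝕜 (G (m + 1) y).1 :=
        RCLike.continuous_conj.comp hG'.fst
      exact (h1.smul hvc).add (((h2.mul hvc.fst).add (h3.mul hvc.snd)).prodMk
        ((hG'.fst.mul hvc.fst).sub (h2.mul hvc.snd)))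
    · intro y
      dsimp only
      rw [pauliMul_add_smul, pauliMul_pauliMul, smul_add, smul_smul, add_comm]
      push_cast
      rw [sq]
    · intro y hy
      obtain ⟨c, hc, hvc⟩ := hva y hy
      have hne : G 0 y ≠ 0 := fun h => h0 m (by omega) y (by
        rw [hy, hy (m + 1), h]; exact left_mem_segment ℝ _ _)
      refine ⟨2 * pauliNorm (G 0 y) * c, mul_pos (mul_pos two_pos (pauliNorm_pos hne)) hc, ?_⟩
      have h1 := hvG y
      rw [hy] at h1
      dsimp only
      rw [hy, h1, hvc, ← add_smul, smul_smul]
      push_cast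
      congr 1
      ring

theorem HasPoleChain.exists_unit_extension {e : Y → 𝕜} (he : Continuous e)
    (h : HasPoleChain e) :
    ∃ u : Y → 𝕜, Continuous u ∧ (∀ y, u y ≠ 0) ∧ ∀ y, ‖e y‖ = 1 → u y = e y := by
  obtain ⟨m, G, hG, hG0, hGm, hG1, hseg⟩ := h
  have hnorm : ∀ (σ : ℝ), σ ^ 2 = 1 → ∀ y,
      pauliNorm (poleLift σ (e y)) = 1 + ‖e y‖ ^ 2 := by
    intro σ hσ y
    simp only [pauliNorm, poleLift]
    rw [norm_smul, mul_pow σ, hσ]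
    rw [show (‖(2 : ℝ)‖ * ‖e y‖) ^ 2 + 1 * (1 - ‖e y‖ ^ 2) ^ 2 = (1 + ‖e y‖ ^ 2) ^ 2 by
      rw [Real.norm_eq_abs, abs_two]; ring]
    exact Real.sqrt_sq (by positivity)
  obtain ⟨v, hvc, hv0, hvG, hva⟩ := exists_continuous_pauliMul_eq hG (a := fun y => (1, e y))
    (by fun_prop) (fun y h => one_ne_zero (congrArg Prod.fst h)) (fun y => by
      have h := RCLike.conj_mul (e y)
      rw [hG0, hnorm 1 (by norm_num)]
      push_cast
      rw [← h]
      ext <;> simp [poleLift, pauliMul, RCLike.real_smul_eq_coe_mul, map_ofNat] <;>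
        rw [← h] <;> ring) m hseg
  have hv2 : ∀ y, (v y).2 ≠ 0 := by
    intro y h2
    have h := congrArg Prod.fst (hvG y)
    rw [hGm, hnorm (-1) (by norm_num)] at h
    simp only [poleLift, pauliMul, h2, Prod.smul_fst, smul_eq_mul, mul_zero, add_zero] at h
    push_cast at h
    have h3 : (2 : 𝕜) * (v y).1 = 0 := by linear_combination -h
    have h4 : (v y).1 = 0 := by simpa using h3
    exact hv0 y (Prod.ext h4 h2)
  refine ⟨fun y => ((‖(v y).2‖⁻¹ : ℝ) : 𝕜) * (v y).2, ?_, fun y => ?_, fun y hy => ?_⟩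
  · refine Continuous.mul (RCLike.continuous_ofReal.comp ?_) hvc.snd
    exact (hvc.snd.norm).inv₀ fun y => norm_ne_zero_iff.mpr (hv2 y)
  · exact mul_ne_zero (RCLike.ofReal_ne_zero.mpr (inv_ne_zero (norm_ne_zero_iff.mpr (hv2 y))))
      (hv2 y)
  · obtain ⟨c, hc, hvc⟩ := hva y fun l => by rw [hG1 l y hy, hG1 0 y hy]
    have h2 : (v y).2 = (c : 𝕜) * e y := by rw [hvc]; rfl
    dsimp only
    rw [h2, norm_mul, RCLike.norm_ofReal, hy, abs_of_pos hc, mul_one, ← mul_assoc,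
      ← RCLike.ofReal_mul, inv_mul_cancel₀ hc.ne', RCLike.ofReal_one, one_mul]

end RCLike

theorem HasPoleChain.isEmpty {Y V : Type*} [TopologicalSpace Y] [NormedAddCommGroup V]
    [NormedSpace ℝ V] [Subsingleton V] {e : Y → V} (h : HasPoleChain e) : IsEmpty Y := by
  refine ⟨fun y => ?_⟩
  obtain ⟨m, G, hG, hG0, hGm, hG1, hseg⟩ := h
  have hpos : ∀ l ≤ m, 0 < (G l y).2 := by
    intro l
    induction l with
    | zero =>
      intro _
      rw [hG0, poleLift, Subsingleton.elim (e y) 0]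
      norm_num
    | succ l ih =>
      intro hl
      have h1 := ih (by omega)
      by_contra! h2
      have h3 : 0 < (G l y).2 - (G (l + 1) y).2 := by linarith
      refine hseg l (by omega) y ⟨-(G (l + 1) y).2 / ((G l y).2 - (G (l + 1) y).2),
        (G l y).2 / ((G l y).2 - (G (l + 1) y).2), div_nonneg (by linarith) h3.le,
        div_nonneg h1.le h3.le, by field_simp; ring, Prod.ext (Subsingleton.elim _ _) ?_⟩
      simp only [Prod.snd_add, Prod.smul_snd, smul_eq_mul, Prod.snd_zero]
      field_simp
      ring
  have := hpos m le_rfl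
  rw [hGm, poleLift, Subsingleton.elim (e y) 0] at this
  norm_num at this

/-- The piecewise segment path through `g 0, …, g m`, reparametrised to be smooth. -/
noncomputable def chainPath {E : Type*} [AddCommGroup E] [Module ℝ E] (g : ℕ → E) (m : ℕ) (t : ℝ) :
    E :=
  g 0 + ∑ l ∈ Finset.range m, Real.smoothTransition (t - l) • (g (l + 1) - g l)

section chainPath

variable {E : Type*}

theorem chainPath_zero [AddCommGroup E] [Module ℝ E] (g : ℕ → E) (m : ℕ) :
    chainPath g m 0 = g 0 := by
  rw [chainPath, Finset.sum_eq_zero, add_zero]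
  intro l _
  rw [Real.smoothTransition.zero_of_nonpos (by simp), zero_smul]

theorem chainPath_succ [AddCommGroup E] [Module ℝ E] (g : ℕ → E) (m : ℕ) (t : ℝ) :
    chainPath g (m + 1) t =
      chainPath g m t + Real.smoothTransition (t - m) • (g (m + 1) - g m) := by
  rw [chainPath, chainPath, Finset.sum_range_succ, add_assoc]

theorem chainPath_of_le [AddCommGroup E] [Module ℝ E] (g : ℕ → E) {m : ℕ} {t : ℝ} (h : m ≤ t) :
    chainPath g m t = g m := by
  induction m with
  | zero => simp [chainPath]
  | succ m ih =>
    push_cast at h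
    rw [chainPath_succ, ih (by linarith), Real.smoothTransition.one_of_one_le (by linarith),
      one_smul, add_sub_cancel]

theorem exists_chainPath_mem_segment [AddCommGroup E] [Module ℝ E] (g : ℕ → E) {m : ℕ} {t : ℝ}
    (h0 : 0 ≤ t) (h : t < m) : ∃ l < m, chainPath g m t ∈ segment ℝ (g l) (g (l + 1)) := by
  induction m with
  | zero => exact absurd h (by simpa using h0)
  | succ m ih =>
    rw [chainPath_succ]
    rcases lt_or_ge t m with htm | htm
    · obtain ⟨l, hl, hmem⟩ := ih htm
      refine ⟨l, by omega, ?_⟩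
      rwa [Real.smoothTransition.zero_of_nonpos (by linarith), zero_smul, add_zero]
    · refine ⟨m, by omega, ?_⟩
      rw [chainPath_of_le g htm, segment_eq_image']
      exact ⟨_, ⟨Real.smoothTransition.nonneg _, Real.smoothTransition.le_one _⟩, rfl⟩

theorem chainPath_of_forall_eq [AddCommGroup E] [Module ℝ E] {g : ℕ → E} {a : E}
    (h : ∀ l, g l = a) (m : ℕ) (t : ℝ) : chainPath g m t = a := by
  simp [chainPath, h]

theorem contDiff_chainPath [NormedAddCommGroup E] [NormedSpace ℝ E] (g : ℕ → E) (m : ℕ) :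
    ContDiff ℝ 1 (chainPath g m) := by
  refine contDiff_const.add (ContDiff.sum fun l _ => ContDiff.smul ?_ contDiff_const)
  exact Real.smoothTransition.contDiff.comp (contDiff_id.sub contDiff_const)

theorem continuous_chainPath {Y : Type*} [TopologicalSpace Y] [NormedAddCommGroup E]
    [NormedSpace ℝ E] {G : ℕ → Y → E} (hG : ∀ l, Continuous (G l)) (m : ℕ) :
    Continuous fun p : Y × ℝ => chainPath (fun l => G l p.1) m p.2 := by
  have h := Real.smoothTransition.continuous
  unfold chainPath
  fun_prop

end chainPath

/-- In the presence of partitions of low multiplicity, a family of paths in a space of dimension at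
least three can be perturbed so that each path vanishes at most once. -/
theorem HasFinePartitions.exists_perturbation {Y V : Type*} [PseudoMetricSpace Y] [CompactSpace Y]
    [NormedAddCommGroup V] [NormedSpace ℝ V] [FiniteDimensional ℝ V] {n : ℕ}
    (h : HasFinePartitions Y n) (hV : Module.finrank ℝ V = n) (hn : 3 ≤ n) {F : Y × ℝ → V}
    (hF : Continuous F) (hFd : ∀ y, ContDiff ℝ 1 fun t => F (y, t)) {m ε : ℝ} (hε : 0 < ε) :
    ∃ F' : Y × ℝ → V, Continuous F' ∧ (∀ y, ∀ t ∈ Icc 0 m, ‖F' (y, t) - F (y, t)‖ < ε) ∧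
      ∀ y s t, F' (y, s) = 0 → F' (y, t) = 0 → s = t := by
  classical
  have hunif : ∃ δ > 0, ∀ y z, dist y z < δ → ∀ t ∈ Icc 0 m, ‖F (y, t) - F (z, t)‖ < ε / 2 := by
    obtain ⟨δ, hδ, hδF⟩ := Metric.uniformContinuousOn_iff.mp
      ((isCompact_univ.prod isCompact_Icc).uniformContinuousOn_of_continuous
        (s := (univ : Set Y) ×ˢ Icc 0 m) hF.continuousOn) (ε / 2) (by positivity)
    refine ⟨δ, hδ, fun y z hyz t ht => ?_⟩
    rw [← dist_eq_norm]
    refine hδF (y, t) ⟨mem_univ _, ht⟩ (z, t) ⟨mem_univ _, ht⟩ ?_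
    rw [Prod.dist_eq]
    simpa [hδ] using hyz
  obtain ⟨δ, hδ, hδF⟩ := hunif
  obtain ⟨ι, _, g, hg, hg0, hg1, hmult, hmesh⟩ := h δ hδ
  rcases isEmpty_or_nonempty Y with hY | ⟨⟨y₀⟩⟩
  · exact ⟨F, hF, fun y => hY.elim y, fun y => hY.elim y⟩
  have hbase : ∀ i, ∃ z : Y, ∀ y, g i y ≠ 0 → dist z y < δ := by
    intro i
    by_cases hi : ∃ z, g i z ≠ 0
    · obtain ⟨z, hz⟩ := hi
      exact ⟨z, fun y hy => hmesh i z y hz hy⟩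
    · push Not at hi
      exact ⟨y₀, fun y hy => (hy (hi y)).elim⟩
  choose b hb using hbase
  let D : ι → ℝ × ℝ → V := fun i q =>
    Real.exp (-q.2) • (F (b i, q.1 + Real.exp q.2) - F (b i, q.1))
  have hD : ∀ i, ContDiff ℝ 1 (D i) := by
    intro i
    have h1 := hFd (b i)
    have h2 : ContDiff ℝ 1 fun q : ℝ × ℝ => q.1 + Real.exp q.2 := by fun_prop
    have h3 : ContDiff ℝ 1 fun q : ℝ × ℝ => Real.exp (-q.2) := by fun_prop
    exact h3.smul ((h1.comp h2).sub (h1.comp contDiff_fst))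
  obtain ⟨w, hw, hwv⟩ := Metric.dense_iff.mp (dense_setOf_sum_smul_add_eq_zero_imp
    (Q := ℝ × ℝ) (W := V × V) (fun i q => (F (b i, q.1) - q.1 • D i q, D i q))
    (fun i => (((hFd (b i)).comp contDiff_fst).sub (contDiff_fst.smul (hD i))).prodMk (hD i))
    n (by simp [hV]; omega)) 0 (ε / (2 * (1 + |m|))) (by positivity)
  have hw' : ∀ i, ‖w i‖ < ε / (2 * (1 + |m|)) := by
    intro i
    have := (norm_le_pi_norm w i).trans_lt (by simpa using hw)
    exact this
  let F' : Y × ℝ → V := fun p => ∑ i, g i p.1 • (F (b i, p.2) + (w i).1 + p.2 • (w i).2)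
  refine ⟨F', by fun_prop, fun y t ht => ?_, ?_⟩
  · have h1 : F' (y, t) ∈ ball (F (y, t)) ε := by
      simp only [F', ← finsum_eq_sum_of_fintype]
      refine (convex_ball _ _).finsum_mem (fun i => hg0 i y)
        (by rw [finsum_eq_sum_of_fintype, hg1]) fun i hi => ?_
      have h2 := hδF (b i) y (hb i y hi) t ht
      have h3 : ‖(w i).1 + t • (w i).2‖ < ε / 2 := by
        calc ‖(w i).1 + t • (w i).2‖ ≤ ‖w i‖ + |m| * ‖w i‖ := by
              refine (norm_add_le _ _).trans (add_le_add (norm_fst_le _) ?_)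
              rw [norm_smul, Real.norm_eq_abs, abs_of_nonneg ht.1]
              exact mul_le_mul (ht.2.trans (le_abs_self m)) (norm_snd_le _) (norm_nonneg _)
                (abs_nonneg m)
          _ = (1 + |m|) * ‖w i‖ := by ring
          _ < (1 + |m|) * (ε / (2 * (1 + |m|))) := by gcongr; exact hw' i
          _ = ε / 2 := by field_simp
      rw [mem_ball, dist_eq_norm]
      calc ‖F (b i, t) + (w i).1 + t • (w i).2 - F (y, t)‖
          = ‖(F (b i, t) - F (y, t)) + ((w i).1 + t • (w i).2)‖ := by congr 1; abel
        _ < ε := (norm_add_le _ _).trans_lt (by linarith)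
    rwa [mem_ball, dist_eq_norm] at h1
  · have key : ∀ y s t, s < t → F' (y, s) = 0 → F' (y, t) = 0 → False := by
      intro y s t hst hs ht
      have := hwv (s, Real.log (t - s)) (fun i => g i y) (hmult y) ?_
      · have h1 := hg1 y
        simp only [funext_iff, Pi.zero_apply] at this
        simp [this] at h1
      · have hpos : 0 < t - s := sub_pos.mpr hst
        have h2 : ∑ i, g i y • ((w i).2 + D i (s, Real.log (t - s))) = 0 := by
          have h3 : (t - s) • ∑ i, g i y • ((w i).2 + D i (s, Real.log (t - s))) =
              F' (y, t) - F' (y, s) := by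
            simp only [F', ← Finset.sum_sub_distrib, Finset.smul_sum, D]
            refine Finset.sum_congr rfl fun i _ => ?_
            rw [Real.exp_neg, Real.exp_log hpos, add_sub_cancel, smul_comm, smul_add (t - s),
              smul_inv_smul₀ hpos.ne']
            module
          rw [hs, ht, sub_zero] at h3
          exact (smul_eq_zero.mp h3).resolve_left hpos.ne'
        have h4 : ∑ i, g i y • ((w i).1 +
            (F (b i, s) - s • D i (s, Real.log (t - s)))) = 0 := by
          have h5 : ∑ i, g i y • ((w i).1 + (F (b i, s) - s • D i (s, Real.log (t - s)))) =
              F' (y, s) - s • ∑ i, g i y • ((w i).2 + D i (s, Real.log (t - s))) := by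
            simp only [F', ← Finset.sum_sub_distrib, Finset.smul_sum]
            refine Finset.sum_congr rfl fun i _ => ?_
            module
          rw [h5, h2, hs, smul_zero, sub_zero]
        refine Prod.ext ?_ ?_
        · simpa [Prod.fst_sum] using h4
        · simpa [Prod.snd_sum] using h2
    intro y s t hs ht
    rcases lt_trichotomy s t with hst | hst | hst
    exacts [(key y s t hst hs ht).elim, hst, (key y t s hst ht hs).elim]

theorem exists_eqOn_of_norm_sub_lt {Y V : Type*} [TopologicalSpace Y] [NormalSpace Y]
    [NormedAddCommGroup V] [NormedSpace ℝ V] {u e : Y → V} (hu : Continuous u) (he : Continuous e)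
    (hu0 : ∀ y, u y ≠ 0) {C : Set Y} (hC : IsClosed C) (h : ∀ y ∈ C, ‖u y - e y‖ < ‖e y‖) :
    ∃ v : Y → V, Continuous v ∧ (∀ y, v y ≠ 0) ∧ EqOn v e C := by
  have hO : IsOpen {y | ‖u y - e y‖ < ‖e y‖} := isOpen_lt (by fun_prop) (by fun_prop)
  obtain ⟨μ, hμ0, hμ1, hμ⟩ := exists_continuous_zero_one_of_isClosed hO.isClosed_compl hC
    (disjoint_left.mpr fun y hy hyC => hy (h y hyC))
  refine ⟨fun y => (1 - μ y) • u y + μ y • e y, by fun_prop, fun y hy => ?_, fun y hy => ?_⟩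
  · by_cases hyO : ‖u y - e y‖ < ‖e y‖
    · refine zero_notMem_segment_of_mem_ball (a := u y) (b := e y) (c := e y) ?_ ?_
        ⟨1 - μ y, μ y, by linarith [(hμ y).2], (hμ y).1, by ring, hy⟩
      · rwa [mem_ball, dist_eq_norm]
      · exact mem_ball_self ((norm_nonneg _).trans_lt hyO)
    · have : μ y = 0 := hμ0 hyO
      simp [this] at hy
      exact hu0 y hy
  · have : μ y = 1 := hμ1 hy
    simp [this]

theorem poleLift_ne_zero {V : Type*} [NormedAddCommGroup V] [NormedSpace ℝ V] {s : ℝ} (hs : s ≠ 0)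
    (v : V) : poleLift s v ≠ 0 := by
  intro h
  have h1 : v = 0 := by simpa [poleLift] using congrArg Prod.fst h
  have h2 := congrArg Prod.snd h
  simp [poleLift, h1, hs] at h2

theorem HasPoleChain.exists_unit_extension_of_three_le {Y V : Type*} [MetricSpace Y]
    [CompactSpace Y] [NormedAddCommGroup V] [NormedSpace ℝ V] [FiniteDimensional ℝ V] {n : ℕ}
    {e : Y → V} (he : Continuous e) (he1 : ∀ y, ‖e y‖ ≤ 1) (hchain : HasPoleChain e)
    (h : HasFinePartitions Y n) (hV : Module.finrank ℝ V = n) (hn : 3 ≤ n) :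
    ∃ u : Y → V, Continuous u ∧ (∀ y, u y ≠ 0) ∧ ∀ y, ‖e y‖ = 1 → u y = e y := by
  obtain ⟨m, G, hG, hG0, hGm, hG1, hseg⟩ := hchain
  let H : Y × ℝ → V × ℝ := fun p => chainPath (fun l => G l p.1) m p.2
  have hH : Continuous H := continuous_chainPath hG m
  have hHm : ∀ y, H (y, m) = poleLift (-1) (e y) := fun y => by
    simp only [H]; rw [chainPath_of_le _ le_rfl, hGm]
  have hH0 : ∀ y, H (y, 0) = poleLift 1 (e y) := fun y => by
    simp only [H]; rw [chainPath_zero, hG0]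
  have hHne : ∀ p ∈ (univ : Set Y) ×ˢ Icc 0 (m : ℝ), 0 < ‖H p‖ := by
    rintro ⟨y, t⟩ ⟨-, ht⟩
    rw [norm_pos_iff]
    rcases ht.2.eq_or_lt with rfl | htm
    · rw [hHm]
      exact poleLift_ne_zero (by norm_num) _
    · obtain ⟨l, hl, hmem⟩ := exists_chainPath_mem_segment (fun l => G l y) ht.1 htm
      exact fun h0 => hseg l hl y (h0 ▸ hmem)
  have hcpt : IsCompact ((univ : Set Y) ×ˢ Icc 0 (m : ℝ)) := isCompact_univ.prod isCompact_Icc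
  obtain ⟨c, hc, hcH⟩ := hcpt.exists_forall_le' hH.norm.continuousOn hHne
  obtain ⟨F, hF, hFH, hFu⟩ := h.exists_perturbation hV hn hH.fst
    (fun y => contDiff_fst.comp (contDiff_chainPath (fun l => G l y) m)) (m := m)
    (show 0 < min c 1 by positivity)
  have hzero : ∀ y, ∀ t ∈ Icc 0 (m : ℝ), F (y, t) = 0 → (H (y, t)).2 ≠ 0 := by
    intro y t ht h0 h2
    have h3 := hFH y t ht
    rw [h0, zero_sub, norm_neg] at h3
    have h4 := hcH (y, t) ⟨mem_univ _, ht⟩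
    rw [Prod.norm_def, h2, norm_zero, max_eq_left (norm_nonneg _)] at h4
    exact absurd h3 (not_lt.mpr ((min_le_left _ _).trans h4))
  have hclosed : ∀ S : Set ℝ, IsClosed S →
      IsClosed {y | ∃ t ∈ Icc 0 (m : ℝ), F (y, t) = 0 ∧ (H (y, t)).2 ∈ S} := by
    intro S hS
    have h1 : IsCompact (((univ : Set Y) ×ˢ Icc 0 (m : ℝ)) ∩
        (F ⁻¹' {0} ∩ (fun p => (H p).2) ⁻¹' S)) :=
      hcpt.inter_right ((isClosed_singleton.preimage hF).inter (hS.preimage hH.snd))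
    convert (h1.image continuous_fst).isClosed using 1
    ext y
    constructor
    · rintro ⟨t, ht, h2, h3⟩
      exact ⟨(y, t), ⟨⟨mem_univ _, ht⟩, h2, h3⟩, rfl⟩
    · rintro ⟨⟨y', t⟩, ⟨⟨-, ht⟩, h2, h3⟩, rfl⟩
      exact ⟨t, ht, h2, h3⟩
  obtain ⟨τ, hτ0, hτ1, hτ⟩ := exists_continuous_zero_one_of_isClosed (hclosed _ isClosed_Iic)
    (hclosed _ isClosed_Ici) (s := {y | ∃ t ∈ Icc 0 (m : ℝ), F (y, t) = 0 ∧ (H (y, t)).2 ∈ Iic 0})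
    (t := {y | ∃ t ∈ Icc 0 (m : ℝ), F (y, t) = 0 ∧ (H (y, t)).2 ∈ Ici 0}) (by
      rw [disjoint_left]
      rintro y ⟨s, hs, hs0, hs2⟩ ⟨t, ht, ht0, ht2⟩
      obtain rfl := hFu y s t hs0 ht0
      exact hzero y s hs hs0 (le_antisymm hs2 ht2))
  have hτm : ∀ y, m * τ y ∈ Icc 0 (m : ℝ) := fun y =>
    ⟨mul_nonneg m.cast_nonneg (hτ y).1, mul_le_of_le_one_right m.cast_nonneg (hτ y).2⟩
  have hnorm2 : ∀ y, 0 ≤ 1 - ‖e y‖ ^ 2 := fun y => by nlinarith [he1 y, norm_nonneg (e y)]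
  have hF0 : ∀ y, F (y, m * τ y) ≠ 0 := by
    intro y hy
    have hne := hzero y _ (hτm y) hy
    rcases le_total 0 (H (y, m * τ y)).2 with h2 | h2
    · have h3 : τ y = 1 := hτ1 ⟨_, hτm y, hy, h2⟩
      rw [h3, mul_one, hHm] at h2 hne
      refine hne (le_antisymm ?_ h2)
      simpa [poleLift] using hnorm2 y
    · have h3 : τ y = 0 := hτ0 ⟨_, hτm y, hy, h2⟩
      rw [h3, mul_zero, hH0] at h2 hne
      refine hne (le_antisymm h2 ?_)
      simpa [poleLift] using hnorm2 y
  have hFe : ∀ y ∈ {y | ‖e y‖ = 1}, ‖F (y, m * τ y) - (2 : ℝ) • e y‖ < ‖(2 : ℝ) • e y‖ := by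
    intro y hy
    have h1 := hFH y _ (hτm y)
    have h2 : H (y, m * τ y) = ((2 : ℝ) • e y, 0) :=
      chainPath_of_forall_eq (fun l => hG1 l y hy) _ _
    rw [h2] at h1
    rw [norm_smul, show ‖e y‖ = 1 from hy]
    refine (h1.trans_le (min_le_right _ _)).trans ?_
    norm_num
  obtain ⟨u, hu, hu0, hue⟩ := exists_eqOn_of_norm_sub_lt (u := fun y => F (y, m * τ y))
    (e := fun y => (2 : ℝ) • e y) (by fun_prop) (by fun_prop) hF0
    (isClosed_eq he.norm continuous_const) hFe
  refine ⟨fun y => (2⁻¹ : ℝ) • u y, by fun_prop, fun y => smul_ne_zero (by norm_num) (hu0 y),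
    fun y hy => ?_⟩
  dsimp only
  rw [hue hy]
  simp

/-- Spaces with fine cylinders of multiplicity `n + 1` have unit extensions in dimension `n`. -/
theorem HasFineCylinders.hasUnitExtensions {Y : Type*} [MetricSpace Y] [CompactSpace Y] {n : ℕ}
    (hn : n ≠ 0) (h : HasFineCylinders Y n) :
    ∃ (V : Type) (_ : NormedAddCommGroup V) (_ : NormedSpace ℝ V), Module.finrank ℝ V = n ∧
      HasUnitExtensions Y V := by
  obtain rfl | rfl | hn : n = 1 ∨ n = 2 ∨ 3 ≤ n := by omega
  · have hV : Module.finrank ℝ ℝ = 1 := Module.finrank_self ℝ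
    exact ⟨ℝ, _, inferInstance, hV,
      fun e he he1 => (h.hasPoleChain hV he he1).exists_unit_extension he⟩
  · have hV := Complex.finrank_real_complex
    exact ⟨ℂ, _, inferInstance, hV,
      fun e he he1 => (h.hasPoleChain hV he he1).exists_unit_extension he⟩
  · have hV : Module.finrank ℝ (Fin n → ℝ) = n := by simp
    exact ⟨Fin n → ℝ, _, inferInstance, hV, fun e he he1 =>
      (h.hasPoleChain hV he he1).exists_unit_extension_of_three_le he he1 h.hasFinePartitions hV hn⟩

/-- Nowhere vanishing maps from closed subsets extend to nowhere vanishing maps as soon as they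
extend continuously. -/
theorem HasUnitExtensions.exists_extension {Y V W : Type*} [TopologicalSpace Y] [CompactSpace Y]
    [NormedAddCommGroup V] [NormedSpace ℝ V] [NormedAddCommGroup W] [NormedSpace ℝ W]
    (h : HasUnitExtensions Y V) (φ : W ≃L[ℝ] V) {e : Y → W} (he : Continuous e) {C : Set Y}
    (hC : IsClosed C) (heC : ∀ y ∈ C, e y ≠ 0) :
    ∃ u : Y → W, Continuous u ∧ (∀ y, u y ≠ 0) ∧ EqOn u e C := by
  have hφe : Continuous fun y => φ (e y) := φ.continuous.comp he
  obtain ⟨η, hη, hηC⟩ := hC.isCompact.exists_forall_le' hφe.norm.continuousOn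
    (a := 0) (fun y hy => norm_pos_iff.mpr (by simpa using heC y hy))
  let r : Y → ℝ := fun y => max ‖φ (e y)‖ η
  have hr : Continuous r := hφe.norm.max continuous_const
  have hr0 : ∀ y, 0 < r y := fun y => lt_max_of_lt_right hη
  have hr0' : ∀ y, r y ≠ 0 := fun y => (hr0 y).ne'
  have hnorm : ∀ y, ‖(r y)⁻¹ • φ (e y)‖ = ‖φ (e y)‖ / r y := fun y => by
    rw [norm_smul, norm_inv, Real.norm_of_nonneg (hr0 y).le, div_eq_inv_mul]
  obtain ⟨u, hu, hu0, hue⟩ := h (fun y => (r y)⁻¹ • φ (e y)) ((hr.inv₀ hr0').smul hφe) fun y => by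
    rw [hnorm, div_le_one (hr0 y)]
    exact le_max_left _ _
  refine ⟨fun y => φ.symm (r y • u y), φ.symm.continuous.comp (hr.smul hu), fun y => ?_,
    fun y hy => ?_⟩
  · simpa using ⟨hr0' y, hu0 y⟩
  · have h1 : r y = ‖φ (e y)‖ := max_eq_left (hηC y hy)
    dsimp only
    rw [hue y (by rw [hnorm, h1, div_self (h1 ▸ hr0' y)]), smul_inv_smul₀ (hr0' y),
      φ.symm_apply_apply]

/-- A family of nonnegative continuous functions on a space with unit extensions in dimension `n`,
at most `n + 1` of which are nonzero at each point, can be shrunk so that the members of a given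
subfamily of size `n + 1` are nowhere simultaneously nonzero. -/
theorem HasUnitExtensions.exists_shrink {Y V : Type*} [TopologicalSpace Y] [CompactSpace Y]
    [NormedAddCommGroup V] [NormedSpace ℝ V] [FiniteDimensional ℝ V] (h : HasUnitExtensions Y V)
    {n : ℕ} (hV : Module.finrank ℝ V = n) {ι : Type*} [Finite ι] {g : ι → Y → ℝ}
    (hg : ∀ i, Continuous (g i)) (hg0 : ∀ i y, 0 ≤ g i y) (hne : ∀ y, ∃ i, g i y ≠ 0)
    (hmult : ∀ y, {i | g i y ≠ 0}.ncard ≤ n + 1) {σ : Finset ι} (hσ : σ.card = n + 1) :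
    ∃ g' : ι → Y → ℝ, (∀ i, Continuous (g' i)) ∧ (∀ i y, 0 ≤ g' i y) ∧ (∀ y, ∃ i, g' i y ≠ 0) ∧
      (∀ i y, g' i y ≠ 0 → g i y ≠ 0) ∧ ∀ y, ∃ i ∈ σ, g' i y = 0 := by
  classical
  obtain ⟨i₀, hi₀⟩ : σ.Nonempty := Finset.card_pos.mp (by omega)
  let A : Set Y := {y | ∀ i, i ∉ σ → g i y = 0}
  let Z : Set Y := {y | ∃ i ∈ σ, g i y = 0}
  have hA : IsClosed A := by
    have : A = ⋂ i, ⋂ (_ : i ∉ σ), {y | g i y = 0} := by ext; simp [A]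
    rw [this]
    exact isClosed_iInter fun i => isClosed_iInter fun _ => isClosed_eq (hg i) continuous_const
  have hZ : IsClosed Z := by
    have : Z = ⋃ i ∈ σ, {y | g i y = 0} := by ext; simp [Z]
    rw [this]
    exact σ.finite_toSet.isClosed_biUnion fun i _ => isClosed_eq (hg i) continuous_const
  have hZA : ∀ y, y ∉ A → y ∈ Z := by
    intro y hy
    by_contra hyZ
    simp only [A, Z, mem_ofPred_eq, not_forall, not_exists, not_and] at hy hyZ
    obtain ⟨j, hj, hgj⟩ := hy
    have h1 : ((insert j σ : Finset ι) : Set ι) ⊆ {i | g i y ≠ 0} := by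
      intro i hi
      rcases Finset.mem_insert.mp hi with rfl | hi
      exacts [hgj, hyZ i hi]
    have h2 := (ncard_le_ncard h1 (toFinite _)).trans (hmult y)
    rw [ncard_coe_finset, Finset.card_insert_of_notMem hj] at h2
    omega
  let e : Y → (↥(σ.erase i₀) → ℝ) := fun y i => g i y - g i₀ y
  have he : Continuous e := continuous_pi fun i => (hg i).sub (hg i₀)
  have heC : ∀ y ∈ A ∩ Z, e y ≠ 0 := by
    rintro y ⟨hyA, j, hj, hgj⟩ h0
    have h1 : ∀ i ∈ σ, g i y = g i₀ y := by
      intro i hi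
      by_cases hii : i = i₀
      · rw [hii]
      · exact sub_eq_zero.mp (congrFun h0 ⟨i, Finset.mem_erase.mpr ⟨hii, hi⟩⟩)
    obtain ⟨i, hi⟩ := hne y
    by_cases hiσ : i ∈ σ
    · exact hi (by rw [h1 i hiσ, ← h1 j hj, hgj])
    · exact hi (hyA i hiσ)
  have hdim : Module.finrank ℝ (↥(σ.erase i₀) → ℝ) = Module.finrank ℝ V := by
    rw [Module.finrank_fintype_fun_eq_card, Fintype.card_coe, Finset.card_erase_of_mem hi₀, hV, hσ,
      Nat.add_sub_cancel]
  obtain ⟨u, hu, hu0, hue⟩ := h.exists_extension (ContinuousLinearEquiv.ofFinrankEq hdim) he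
    (hA.inter hZ) heC
  let c : ι → Y → ℝ := fun i y => if hi : i ∈ σ.erase i₀ then u y ⟨i, hi⟩ else 0
  have hc : ∀ i, Continuous (c i) := by
    intro i
    by_cases hi : i ∈ σ.erase i₀
    · simp only [c, hi, dif_pos]
      fun_prop
    · simp only [c, hi, dif_neg, not_false_eq_true]
      fun_prop
  let M : Y → ℝ := fun y => σ.inf' ⟨i₀, hi₀⟩ fun i => c i y
  have hM : Continuous M := Continuous.finset_inf'_apply _ fun i _ => hc i
  have hMc : ∀ y, ∀ i ∈ σ, M y ≤ c i y := fun y i hi => Finset.inf'_le _ hi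
  have hMex : ∀ y, ∃ i ∈ σ, M y = c i y := fun y => Finset.exists_mem_eq_inf' _ _
  have hcg : ∀ y ∈ A ∩ Z, ∀ i ∈ σ, c i y = g i y - g i₀ y := by
    intro y hy i hi
    by_cases hii : i = i₀
    · simp [c, hii]
    · have h1 : i ∈ σ.erase i₀ := Finset.mem_erase.mpr ⟨hii, hi⟩
      simp only [c, h1, dif_pos]
      rw [hue hy]
  have hcM : ∀ y ∈ A ∩ Z, ∀ i ∈ σ, c i y - M y = g i y := by
    intro y hy i hi
    have h1 : M y = - g i₀ y := by
      obtain ⟨j, hj, hgj⟩ := hy.2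
      obtain ⟨l, hl, hMl⟩ := hMex y
      refine le_antisymm ?_ ?_
      · have := hMc y j hj
        rw [hcg y hy j hj] at this
        linarith
      · rw [hMl, hcg y hy l hl]
        linarith [hg0 l y]
    rw [hcg y hy i hi, h1]
    ring
  let g' : ι → Y → ℝ := fun i y => if i ∈ σ ∧ y ∈ A then c i y - M y else g i y
  have hg'A : ∀ i ∈ σ, ∀ y ∈ A, g' i y = c i y - M y := fun i hi y hy => if_pos ⟨hi, hy⟩
  have hg'Z : ∀ i, ∀ y ∈ Z, g' i y = g i y := by
    intro i y hy
    by_cases hi : i ∈ σ ∧ y ∈ A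
    · rw [hg'A i hi.1 y hi.2, hcM y ⟨hi.2, hy⟩ i hi.1]
    · exact if_neg hi
  have hg'σ : ∀ i, i ∉ σ → g' i = g i := fun i hi => funext fun y => if_neg fun h => hi h.1
  refine ⟨g', fun i => ?_, fun i y => ?_, fun y => ?_, fun i y => ?_, fun y => ?_⟩
  · by_cases hi : i ∈ σ
    · have hAZ : A ∪ Z = univ := eq_univ_of_forall fun y => or_iff_not_imp_left.mpr (hZA y)
      rw [← continuousOn_univ, ← hAZ]
      exact ContinuousOn.union_of_isClosed (((hc i).sub hM).continuousOn.congr (hg'A i hi))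
        ((hg i).continuousOn.congr (hg'Z i)) hA hZ
    · rw [hg'σ i hi]
      exact hg i
  · simp only [g']
    split_ifs with hi
    exacts [sub_nonneg.mpr (hMc y i hi.1), hg0 i y]
  · by_cases hy : y ∈ A
    · by_contra! h0
      refine hu0 y (funext fun i => ?_)
      have h1 : ∀ j ∈ σ, c j y = M y := fun j hj =>
        sub_eq_zero.mp ((hg'A j hj y hy).symm.trans (h0 j))
      have h2 : c i y = u y i := by simp only [c, i.2, dif_pos]
      have h3 : c i₀ y = 0 := by simp [c]
      rw [← h2, h1 i (Finset.mem_of_mem_erase i.2), ← h1 i₀ hi₀, h3]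
      rfl
    · obtain ⟨i, hi⟩ := hne y
      exact ⟨i, by rwa [hg'Z i y (hZA y hy)]⟩
  · intro hi h0
    by_cases hiσ : i ∈ σ ∧ y ∈ A
    · rw [hg'Z i y ⟨i, hiσ.1, h0⟩] at hi
      exact hi h0
    · exact hi ((if_neg hiσ).trans h0)
  · by_cases hy : y ∈ A
    · obtain ⟨i, hi, hMi⟩ := hMex y
      exact ⟨i, hi, by rw [hg'A i hi y hy, hMi, sub_self]⟩
    · obtain ⟨i, hi, h0⟩ := hZA y hy
      exact ⟨i, hi, by rw [hg'Z i y (hZA y hy), h0]⟩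

theorem HasUnitExtensions.exists_shrink_ncard_le {Y V : Type*} [TopologicalSpace Y] [CompactSpace Y]
    [NormedAddCommGroup V] [NormedSpace ℝ V] [FiniteDimensional ℝ V] (h : HasUnitExtensions Y V)
    {n : ℕ} (hV : Module.finrank ℝ V = n) {ι : Type*} [Finite ι] {g : ι → Y → ℝ}
    (hg : ∀ i, Continuous (g i)) (hg0 : ∀ i y, 0 ≤ g i y) (hne : ∀ y, ∃ i, g i y ≠ 0)
    (hmult : ∀ y, {i | g i y ≠ 0}.ncard ≤ n + 1) :
    ∃ g' : ι → Y → ℝ, (∀ i, Continuous (g' i)) ∧ (∀ y, ∃ i, g' i y ≠ 0) ∧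
      (∀ i y, g' i y ≠ 0 → g i y ≠ 0) ∧ ∀ y, {i | g' i y ≠ 0}.ncard ≤ n := by
  classical
  have _ := Fintype.ofFinite ι
  have key : ∀ 𝒮 : Finset (Finset ι), (∀ σ ∈ 𝒮, σ.card = n + 1) →
      ∃ g' : ι → Y → ℝ, (∀ i, Continuous (g' i)) ∧ (∀ i y, 0 ≤ g' i y) ∧ (∀ y, ∃ i, g' i y ≠ 0) ∧
        (∀ i y, g' i y ≠ 0 → g i y ≠ 0) ∧ ∀ σ ∈ 𝒮, ∀ y, ∃ i ∈ σ, g' i y = 0 := by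
    intro 𝒮
    induction 𝒮 using Finset.induction with
    | empty => exact fun _ => ⟨g, hg, hg0, hne, fun i y => id, by simp⟩
    | insert σ 𝒮 hσ ih =>
      intro hcard
      obtain ⟨g₁, hc, h0, hne₁, hsub, h𝒮⟩ :=
        ih fun σ' hσ' => hcard σ' (Finset.mem_insert_of_mem hσ')
      obtain ⟨g₂, hc₂, h0₂, hne₂, hsub₂, hσ₂⟩ := h.exists_shrink hV hc h0 hne₁
        (fun y => (ncard_le_ncard (fun i hi => hsub i y hi) (toFinite _)).trans (hmult y))
        (hcard σ (Finset.mem_insert_self _ _))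
      refine ⟨g₂, hc₂, h0₂, hne₂, fun i y hi => hsub i y (hsub₂ i y hi), fun σ' hσ' y => ?_⟩
      rcases Finset.mem_insert.mp hσ' with rfl | hσ'
      · exact hσ₂ y
      · obtain ⟨i, hi, hi0⟩ := h𝒮 σ' hσ' y
        exact ⟨i, hi, by_contra fun hi' => hsub₂ i y hi' hi0⟩
  obtain ⟨g', hc, -, hne', hsub, hσ⟩ := key (Finset.univ.powersetCard (n + 1))
    fun σ hσ => (Finset.mem_powersetCard.mp hσ).2
  refine ⟨g', hc, hne', hsub, fun y => ?_⟩
  by_contra! hlt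
  obtain ⟨σ, hσs, hσc⟩ := Finset.exists_subset_card_eq
    (s := {i | g' i y ≠ 0}.toFinset) (n := n + 1) (by rwa [← ncard_eq_toFinset_card'])
  obtain ⟨i, hi, hi0⟩ := hσ σ (Finset.mem_powersetCard.mpr ⟨Finset.subset_univ _, hσc⟩) y
  exact (mem_toFinset.mp (hσs hi)) hi0

/-- A space with partitions of multiplicity `n + 2` whose unit maps of dimension `n + 1` extend has
covering dimension at most `n`. -/
theorem HasUnitExtensions.dimLE {Y V : Type*} [MetricSpace Y] [CompactSpace Y]
    [NormedAddCommGroup V] [NormedSpace ℝ V] [FiniteDimensional ℝ V] (h : HasUnitExtensions Y V)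
    {n : ℕ} (hV : Module.finrank ℝ V = n + 1) (hpart : HasFinePartitions Y (n + 1)) :
    DimLE Y n := by
  classical
  refine Or.inr ⟨n, rfl, fun α _ hαo hαc => ?_⟩
  obtain ⟨δ, hδ, hδα⟩ := lebesgue_number_lemma_of_metric_sUnion isCompact_univ hαo hαc.ge
  obtain ⟨ι, _, g, hg, hg0, hg1, hmult, hmesh⟩ := hpart δ hδ
  obtain ⟨g', hc, hne, hsub, hmult'⟩ := h.exists_shrink_ncard_le hV hg hg0 (fun y => by
    by_contra! h0
    simpa [h0] using hg1 y) hmult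
  let B : ι → Set Y := fun i => {y | g' i y ≠ 0}
  rcases isEmpty_or_nonempty Y with hY | ⟨⟨y₀⟩⟩
  · exact ⟨∅, finite_empty, by simp, Subsingleton.elim _ _, fun _ h => h.elim, fun S hS _ => by
      rw [subset_empty_iff, Finset.coe_eq_empty] at hS
      simp [hS]⟩
  refine ⟨range B, finite_range B, ?_, ?_, ?_, ?_⟩
  · rintro _ ⟨i, rfl⟩
    exact isOpen_ne_fun (hc i) continuous_const
  · refine eq_univ_of_forall fun y => ?_
    obtain ⟨i, hi⟩ := hne y
    exact ⟨B i, mem_range_self i, hi⟩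
  · rintro _ ⟨i, rfl⟩
    by_cases hi : (B i).Nonempty
    · obtain ⟨y, hy⟩ := hi
      obtain ⟨U, hU, hUs⟩ := hδα y (mem_univ y)
      exact ⟨U, hU, fun z hz => hUs (hmesh i z y (hsub i z hz) (hsub i y hy))⟩
    · obtain ⟨U, hU, -⟩ := hδα y₀ (mem_univ y₀)
      exact ⟨U, hU, fun z hz => (hi ⟨z, hz⟩).elim⟩
  · rintro S hS ⟨y, hy⟩
    have h1 : (S : Set (Set Y)) ⊆ B '' {i | g' i y ≠ 0} := by
      intro U hU
      obtain ⟨i, rfl⟩ := hS hU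
      exact ⟨i, hy _ hU, rfl⟩
    rw [← ncard_coe_finset]
    exact (ncard_le_ncard h1 (toFinite _)).trans ((ncard_image_le (toFinite _)).trans (hmult' y))

theorem hasFineCylinders_of_forall_exists_cover.{u} {Y : Type u} [MetricSpace Y] [CompactSpace Y]
    {n : ℕ} (h : ∀ δ > (0 : ℝ), ∃ (A : Type u) (m : ℕ) (O : ℕ → A → Set Y) (s : A → ℝ),
      (∀ l a, IsOpen (O l a)) ∧ (∀ l y, ∃ a, y ∈ O l a) ∧
      (∀ l y, ∀ S : Finset A, (∀ a ∈ S, y ∈ O l a ∨ y ∈ O (l + 1) a) → S.card ≤ n + 1) ∧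
      (∀ a k l y z, y ∈ O k a → z ∈ O l a → dist y z < δ) ∧
      (∀ a, |s a| ≤ 1) ∧ (∀ a y, y ∈ O 0 a → s a = 1) ∧ (∀ a y, y ∈ O m a → s a = -1)) :
    HasFineCylinders Y n := by
  classical
  intro δ hδ
  obtain ⟨A, m, O, s, hO, hcov, hmult, hmesh, hs, hs0, hsm⟩ := h δ hδ
  have hfin : ∀ l, ∃ F : Finset A, ∀ y, ∃ a ∈ F, y ∈ O l a := by
    intro l
    obtain ⟨F, hF⟩ := isCompact_univ.elim_finite_subcover (O l) (hO l)
      fun y _ => mem_iUnion.mpr (hcov l y)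
    exact ⟨F, fun y => by simpa using hF (mem_univ y)⟩
  choose F hF using hfin
  let F' : Finset A := (Finset.range (m + 1)).biUnion F
  have hpart : ∀ l, ∃ q : PartitionOfUnity ↥F' Y, q.IsSubordinate fun a => O (min l m) a := by
    intro l
    refine PartitionOfUnity.exists_isSubordinate isClosed_univ _ (fun a => hO _ _) fun y _ => ?_
    obtain ⟨a, ha, hy⟩ := hF (min l m) y
    exact mem_iUnion.mpr ⟨⟨a, Finset.mem_biUnion.mpr
      ⟨min l m, Finset.mem_range.mpr (by omega), ha⟩⟩, hy⟩
  choose q hq using hpart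
  have hqO : ∀ l a y, q l a y ≠ 0 → y ∈ O (min l m) a := fun l a y hy =>
    hq l a (subset_tsupport _ hy)
  refine ⟨↥F', inferInstance, m, fun l a y => q l a y, fun a => s a, fun l a => (q l a).continuous,
    fun l a y => (q l).nonneg a y, fun l y => ?_, fun l y => ?_,
    fun a k l y z hy hz => hmesh a _ _ y z (hqO _ _ _ hy) (hqO _ _ _ hz), fun a => hs a,
    fun a y hy => hs0 a y ?_, fun a y hy => hsm a y ?_⟩
  · rw [← finsum_eq_sum_of_fintype]
    exact (q l).sum_eq_one (mem_univ y)
  · let S : Finset A := (Finset.univ.filter fun a : ↥F' => q l a y ≠ 0 ∨ q (l + 1) a y ≠ 0).map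
      (Function.Embedding.subtype _)
    have h1 : ∀ a ∈ S, y ∈ O (min l m) a ∨ y ∈ O (min l m + 1) a := by
      intro a ha
      obtain ⟨b, hb, rfl⟩ := Finset.mem_map.mp ha
      rcases (Finset.mem_filter.mp hb).2 with hb | hb
      · exact Or.inl (hqO _ _ _ hb)
      · rcases Nat.lt_or_ge l m with hl | hl
        · refine Or.inr ?_
          have := hqO _ _ _ hb
          rwa [show min (l + 1) m = min l m + 1 by omega] at this
        · refine Or.inl ?_
          have := hqO _ _ _ hb
          rwa [show min (l + 1) m = min l m by omega] at this
    have h2 := hmult _ y S h1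
    rw [Finset.card_map] at h2
    rwa [ncard_eq_toFinset_card', Set.toFinset_ofPred]
  · simpa using hqO 0 a y hy
  · simpa using hqO m a y hy

section

variable {T : Type*} [MetricSpace T]

/-- The largest distance from a point of `X` to the set of points at distance at least `t` from
`X`. -/
noncomputable def remoteDist (X : Set T) (t : ℝ) : ℝ :=
  ⨆ x : X, infDist (x : T) {z : T | infDist z X < t}ᶜ

theorem infDist_le_remoteDist [CompactSpace T] {X : Set T} {x : T} (hx : x ∈ X) (t : ℝ) :
    infDist x {z : T | infDist z X < t}ᶜ ≤ remoteDist X t := by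
  have h := (isCompact_range (continuous_infDist_pt ({z : T | infDist z X < t}ᶜ))).bddAbove
  exact le_ciSup (f := fun x : X => infDist (x : T) {z : T | infDist z X < t}ᶜ)
    (h.mono (range_subset_iff.mpr fun x => mem_range_self (x : T))) ⟨x, hx⟩

theorem exists_dist_le_remoteDist [CompactSpace T] {X : Set T} {x : T} (hx : x ∈ X) {t : ℝ}
    (ht : ∃ z, t ≤ infDist z X) : ∃ z, t ≤ infDist z X ∧ dist x z ≤ remoteDist X t := by
  have hcl : IsClosed {z : T | infDist z X < t}ᶜ :=
    (isOpen_lt (continuous_infDist_pt X) continuous_const).isClosed_compl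
  obtain ⟨z, hz, hxz⟩ := hcl.isCompact.exists_infDist_eq_dist
    (ht.imp fun z hz => by simpa using hz) x
  exact ⟨z, by simpa using hz, hxz ▸ infDist_le_remoteDist hx t⟩

theorem remoteDist_mono [CompactSpace T] {X : Set T} {s t : ℝ} (hst : s ≤ t)
    (ht : ∃ z, t ≤ infDist z X) : remoteDist X s ≤ remoteDist X t := by
  refine Real.iSup_le (fun x => ?_) (Real.iSup_nonneg fun _ => infDist_nonneg)
  refine (infDist_le_infDist_of_subset (fun z hz => ?_) (ht.imp fun z hz => by simpa using hz)).trans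
    (infDist_le_remoteDist x.2 t)
  simp only [mem_compl_iff, mem_ofPred_eq, not_lt] at hz ⊢
  exact hst.trans hz

theorem tendsto_remoteDist [CompactSpace T] {X : Set T} (hX : IsClosed X) (hXd : Dense Xᶜ) :
    Tendsto (remoteDist X) (𝓝[>] 0) (𝓝 0) := by
  refine tendsto_order.mpr ⟨fun a ha => Eventually.of_forall fun t =>
    ha.trans_le (Real.iSup_nonneg fun _ => infDist_nonneg), fun ε hε => ?_⟩
  obtain ⟨F, hF⟩ := isCompact_univ.elim_finite_subcover (fun z : ↥Xᶜ => ball (z : T) (ε / 2))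
    (fun _ => isOpen_ball) fun x _ => by
      obtain ⟨z, hz, hzX⟩ := Metric.dense_iff.mp hXd x (ε / 2) (by positivity)
      exact mem_iUnion.mpr ⟨⟨z, hzX⟩, mem_ball_comm.mp hz⟩
  have hev : ∀ᶠ t in 𝓝[>] (0 : ℝ), ∀ z ∈ F, X.Nonempty → t < infDist (z : T) X := by
    rw [eventually_all_finset]
    intro z _
    by_cases hne : X.Nonempty
    · filter_upwards [Ioo_mem_nhdsGT ((hX.notMem_iff_infDist_pos hne).mp z.2)] with t ht _
      exact ht.2
    · exact Eventually.of_forall fun _ h => (hne h).elim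
  filter_upwards [hev] with t ht
  refine lt_of_le_of_lt (Real.iSup_le (fun x => ?_) (half_pos hε).le) (half_lt_self hε)
  obtain ⟨z, hz, hxz⟩ := mem_iUnion₂.mp (hF (mem_univ (x : T)))
  exact (infDist_le_dist_of_mem (by simpa using (ht z hz ⟨x, x.2⟩).le)).trans (le_of_lt hxz)

end

theorem IsUniformFam.exists_forall_dist_lt {T : Type*} [MetricSpace T] {X : Set T}
    (hX : IsClosed X) (hXne : X.Nonempty) {α : Set (Set T)} (hα : IsUniformFam Xᶜ α) {ε : ℝ}
    (hε : 0 < ε) :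
    ∃ η > 0, ∀ U ∈ α, ∀ y ∈ U, ∀ z ∈ U, infDist y X < η → dist y z < ε := by
  obtain ⟨K, hKX, hK, hKε⟩ := hα.2 ε hε
  obtain ⟨η, hη, hηK⟩ := hK.exists_forall_le' (continuous_infDist_pt X).continuousOn
    fun y hy => (hX.notMem_iff_infDist_pos hXne).mp (hKX hy)
  refine ⟨η, hη, fun U hU y hy z hz hyη => hKε (y, z) ⟨?_, fun h => ?_⟩⟩
  · exact mem_biUnion hU ⟨hy, hz⟩
  · exact hyη.not_ge (hηK y h.1)

theorem IsUniformCover.hasFineCylinders {T : Type*} [MetricSpace T] [CompactSpace T] {X : Set T}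
    (hX : IsClosed X) (hXd : Dense Xᶜ) (hXne : X.Nonempty) {k : ℝ} (hk0 : 0 < k)
    (hk : ∃ z, k ≤ infDist z X) {lam : ℝ → ℝ} (hlam_pos : ∀ t ∈ Ioc 0 k, 0 < lam t)
    (hlam_mono : ∀ s ∈ Ioc 0 k, ∀ t ∈ Ioc 0 k, s ≤ t → lam s ≤ lam t)
    (hlam_lim : Tendsto lam (𝓝[>] (0 : ℝ)) (𝓝 0)) {E : Set (T × T)}
    (hE : ∀ y ∈ Xᶜ, ∀ z ∈ Xᶜ, ∀ t, t = min (infDist y X) (infDist z X) → t + lam t ≤ k →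
      dist y z < remoteDist X t + lam t + remoteDist X (t + lam t) → (y, z) ∈ E)
    {α : Set (Set T)} (hα : IsUniformCover Xᶜ α) {n : ℕ}
    (hmult : ∀ x : T, ∀ S : Finset (Set T), ↑S ⊆ α →
      (∀ U ∈ S, (U ∩ {y : T | (y, x) ∈ E}).Nonempty) → S.card ≤ n + 1) :
    HasFineCylinders X n := by
  classical
  have _ : CompactSpace X := isCompact_iff_compactSpace.mp hX.isCompact
  have hpos : ∀ z, 0 < infDist z X → z ∈ Xᶜ := fun z hz => (hX.notMem_iff_infDist_pos hXne).mpr hz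
  have hαX : ∀ U ∈ α, ∀ y ∈ U, y ∈ Xᶜ := fun U hU y hy => hα.2 ▸ mem_sUnion_of_mem hy hU
  have hid : Tendsto (fun t : ℝ => t) (𝓝[>] 0) (𝓝 0) := tendsto_id.mono_left nhdsWithin_le_nhds
  have hrem := tendsto_remoteDist hX hXd
  have hev : ∀ ε > (0 : ℝ), ∀ᶠ t in 𝓝[>] (0 : ℝ), t ∈ Ioc 0 ε := fun ε hε => Ioc_mem_nhdsGT hε
  refine hasFineCylinders_of_forall_exists_cover fun δ hδ => ?_
  obtain ⟨T₁, hT₁ : 0 < T₁, hT₁k⟩ : ∃ T₁ ∈ Ioi (0 : ℝ), Ioc 0 T₁ ⊆ {t | t ≤ k ∧ t + lam t ≤ k} := by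
    refine mem_nhdsGT_iff_exists_Ioc_subset.mp ?_
    have h1 : Tendsto (fun t => t + lam t) (𝓝[>] 0) (𝓝 0) := by simpa using hid.add hlam_lim
    exact (hid.eventually_le_const hk0).and (h1.eventually_le_const hk0)
  obtain ⟨η, hη, hηα⟩ := hα.1.exists_forall_dist_lt hX hXne (half_pos hδ)
  obtain ⟨T₂, hT₂rem, hT₂0, hT₂k, hT₂1⟩ : ∃ t, remoteDist X t < min (min (η / 2) (δ / 8)) T₁ ∧
      0 < t ∧ t ≤ k ∧ t ≤ T₁ := by
    obtain ⟨t, h1, h2, h3⟩ := ((hrem.eventually_lt_const (u := min (min (η / 2) (δ / 8)) T₁)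
      (by positivity)).and ((hev k hk0).and (hev T₁ hT₁))).exists
    exact ⟨t, h1, h2.1, h2.2, h3.2⟩
  obtain ⟨η₂, hη₂, hη₂α⟩ := hα.1.exists_forall_dist_lt hX hXne (show 0 < T₂ / 4 by positivity)
  obtain ⟨τ, hτrem, hτlam, hτ0, hτT⟩ : ∃ t, remoteDist X t < min (η₂ / 2) (T₂ / 8) ∧
      lam t < min (min (min (η / 2) (δ / 8)) (T₂ / 8)) (η₂ / 2) ∧ 0 < t ∧ t ≤ T₂ / 4 := by
    obtain ⟨t, h1, h2, h3⟩ := ((hrem.eventually_lt_const (u := min (η₂ / 2) (T₂ / 8))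
      (by positivity)).and ((hlam_lim.eventually_lt_const
        (u := min (min (min (η / 2) (δ / 8)) (T₂ / 8)) (η₂ / 2)) (by positivity)).and
        (hev (T₂ / 4) (by positivity)))).exists
    exact ⟨t, h1, h2, h3.1, h3.2⟩
  simp only [lt_min_iff] at hT₂rem hτrem hτlam
  obtain ⟨⟨hT₂η, hT₂δ⟩, hT₂T₁⟩ := hT₂rem
  obtain ⟨⟨⟨hτη, hτδ⟩, hτT₂⟩, hτη₂⟩ := hτlam
  set c := lam τ with hc
  have hc0 : 0 < c := hlam_pos τ ⟨hτ0, by linarith⟩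
  let m := ⌊(T₂ - τ) / c⌋₊
  let t : ℕ → ℝ := fun i => τ + ((m - i : ℕ) : ℝ) * c
  have hm : m * c ≤ T₂ - τ := by
    rw [← le_div_iff₀ hc0]
    exact Nat.floor_le (div_nonneg (by linarith) hc0.le)
  have hm' : T₂ - τ < (m + 1) * c := by
    rw [← div_lt_iff₀ hc0]
    exact Nat.lt_floor_add_one _
  have htτ : ∀ i, τ ≤ t i := fun i => le_add_of_nonneg_right (by positivity)
  have htT : ∀ i, t i ≤ T₂ := by
    intro i
    have h1 : ((m - i : ℕ) : ℝ) * c ≤ m * c := by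
      gcongr
      exact Nat.sub_le _ _
    simp only [t]
    linarith
  have ht0 : T₂ / 2 ≤ t 0 := by
    simp only [t, Nat.sub_zero]
    linarith
  have htm : t m = τ := by simp [t]
  have ht1 : ∀ i, t (i + 1) ≤ t i := by
    intro i
    simp only [t]
    gcongr
    omega
  have ht2 : ∀ i, t i ≤ t (i + 1) + c := by
    intro i
    have h1 : ((m - i : ℕ) : ℝ) ≤ ((m - (i + 1) : ℕ) : ℝ) + 1 := by exact_mod_cast by omega
    simp only [t]
    nlinarith
  have hex : ∀ s ≤ k, ∃ z, s ≤ infDist z X := fun s hs => hk.imp fun z hz => hs.trans hz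
  have hremT : ∀ i, remoteDist X (t i) ≤ remoteDist X T₂ := fun i =>
    remoteDist_mono (htT i) (hex _ hT₂k)
  let O : ℕ → α → Set X := fun i U =>
    {x | ∃ y ∈ (U : Set T), t i ≤ infDist y X ∧ dist (x : T) y < remoteDist X (t i) + c / 4}
  let s : α → ℝ := fun U => if ∃ z ∈ (U : Set T), T₂ / 2 ≤ infDist z X then 1 else -1
  refine ⟨α, m, O, s, fun l U => ?_, fun l x => ?_, fun l x S hS => ?_,
    fun U i j x x' hx hx' => ?_, fun U => ?_, fun U x hx => ?_, fun U x hx => ?_⟩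
  · have : O l U = ⋃ y ∈ (U : Set T) ∩ {y | t l ≤ infDist y X},
        {x : X | dist (x : T) y < remoteDist X (t l) + c / 4} := by
      ext x
      simp [O, and_assoc]
    rw [this]
    exact isOpen_biUnion fun y _ => isOpen_lt (by fun_prop) continuous_const
  · obtain ⟨z, hz, hxz⟩ := exists_dist_le_remoteDist x.2 (hex (t l) ((htT l).trans hT₂k))
    have hzX : z ∈ ⋃₀ α := hα.2.symm ▸ hpos z (hτ0.trans_le ((htτ l).trans hz))
    obtain ⟨U, hU, hzU⟩ := hzX
    exact ⟨⟨U, hU⟩, z, hzU, hz, by linarith⟩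
  · obtain ⟨z, hz, hxz⟩ := exists_dist_le_remoteDist x.2 (hex (t (l + 1)) ((htT _).trans hT₂k))
    have hzpos : 0 < infDist z X := hτ0.trans_le ((htτ _).trans hz)
    have hzT₁ : infDist z X ≤ T₁ := by
      have h1 := infDist_le_dist_of_mem (x := z) x.2
      rw [dist_comm] at h1
      linarith [hremT (l + 1)]
    have hS' : ∀ U ∈ S.map (Function.Embedding.subtype _),
        (U ∩ {y : T | (y, z) ∈ E}).Nonempty := by
      intro U hU
      obtain ⟨U, hUS, rfl⟩ := Finset.mem_map.mp hU
      have hw : ∃ y ∈ (U : Set T), t (l + 1) ≤ infDist y X ∧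
          dist (x : T) y < remoteDist X (t l) + c / 4 := by
        rcases hS U hUS with ⟨y, hyU, hy, hxy⟩ | ⟨y, hyU, hy, hxy⟩
        · exact ⟨y, hyU, (ht1 l).trans hy, hxy⟩
        · refine ⟨y, hyU, hy, hxy.trans_le ?_⟩
          gcongr
          exact remoteDist_mono (ht1 l) (hex _ ((htT l).trans hT₂k))
      obtain ⟨y, hyU, hy, hxy⟩ := hw
      refine ⟨y, hyU, hE y (hαX U U.2 y hyU) z (hpos z hzpos) _ rfl ?_ ?_⟩
      · exact (hT₁k ⟨lt_min (hτ0.trans_le ((htτ _).trans hy)) hzpos,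
          (min_le_right _ _).trans hzT₁⟩).2
      · set r := min (infDist y X) (infDist z X) with hr
        have hr1 : t (l + 1) ≤ r := le_min hy hz
        have hr0 : 0 < r := hτ0.trans_le ((htτ _).trans hr1)
        obtain ⟨hrk', hrk⟩ := hT₁k ⟨hr0, (min_le_right _ _).trans hzT₁⟩
        have hcr : c ≤ lam r :=
          hlam_mono τ ⟨hτ0, by linarith⟩ r ⟨hr0, hrk'⟩ ((htτ _).trans hr1)
        have h1 := remoteDist_mono hr1 (hex r hrk')
        have h2 := remoteDist_mono (X := X) (show t l ≤ r + lam r by linarith [ht2 l]) (hex _ hrk)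
        have h3 := dist_triangle_left y z (x : T)
        linarith
    have h1 := hmult z _ (by simp) hS'
    rwa [Finset.card_map] at h1
  · obtain ⟨y, hyU, hy, hxy⟩ := hx
    obtain ⟨y', hyU', hy', hxy'⟩ := hx'
    have h1 := infDist_le_dist_of_mem (x := y) x.2
    rw [dist_comm] at h1
    have h2 := hηα U U.2 y hyU y' hyU' (by linarith [hremT i])
    have h3 := dist_triangle4 (x : T) y y' x'
    rw [dist_comm y' x'] at h3
    rw [Subtype.dist_eq]
    linarith [hremT i, hremT j]
  · simp only [s]
    split_ifs <;> simp
  · obtain ⟨y, hyU, hy, hxy⟩ := hx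
    exact if_pos ⟨y, hyU, ht0.trans hy⟩
  · obtain ⟨y, hyU, hy, hxy⟩ := hx
    refine if_neg ?_
    rintro ⟨z, hzU, hz⟩
    rw [htm] at hxy
    have h1 := infDist_le_dist_of_mem (x := y) x.2
    rw [dist_comm] at h1
    have h2 := hη₂α U U.2 y hyU z hzU (by linarith)
    have h3 := infDist_le_infDist_add_dist (s := X) (x := z) (y := y)
    rw [dist_comm] at h3
    linarith

/-- With `k = sup_z d(z,X)`, an increasing continuous
`λ : (0,k] → (0,∞)` with `λ(t) → 0` as `t → 0⁺`, `h(t) = sup_{x ∈ X} d(x, X̃ \ B(X,t))`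
for `t ≤ k` and `h(t) = k` for `t ≥ k`, and `φ(t) = h(t) + λ(t) + h(t + λ(t))`, the set
`E_{d,λ} = {(x,y) ∈ X̂ × X̂ : d(x,y) < φ(min(d(x,X), d(y,X)))}` belongs to `ℰ₀`, and
every uniform cover `α` of `X̂` with `mult_{E_{d,λ}} α ≤ n + 1` forces `dim X ≤ n − 1`
(that is, `mult_{E_{d,λ}} α ≥ dim X + 2`). -/
theorem statement17 {T : Type*} [MetricSpace T] [CompactSpace T]
    (X : Set T) (hXcl : IsClosed X) (hXnd : IsNowhereDense X)
    (k : ℝ) (hk : k = ⨆ z : T, infDist z X)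
    (lam : ℝ → ℝ)
    (hlam_pos : ∀ t ∈ Set.Ioc 0 k, 0 < lam t)
    (hlam_mono : ∀ s ∈ Set.Ioc 0 k, ∀ t ∈ Set.Ioc 0 k, s ≤ t → lam s ≤ lam t)
    (hlam_cont : ContinuousOn lam (Set.Ioc 0 k))
    (hlam_lim : Filter.Tendsto lam (𝓝[>] (0 : ℝ)) (𝓝 0))
    (hfun : ℝ → ℝ)
    (hhfun : ∀ t : ℝ, hfun t =
      if t ≤ k then ⨆ x : X, infDist (x : T) {z : T | infDist z X < t}ᶜ else k)
    (phifun : ℝ → ℝ)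
    (hphifun : ∀ t : ℝ, phifun t = hfun t + lam t + hfun (t + lam t))
    (E : Set (T × T))
    (hEdef : E = {p : T × T | p ∈ Xᶜ ×ˢ Xᶜ ∧
      dist p.1 p.2 < phifun (min (infDist p.1 X) (infDist p.2 X))}) :
    MemC0 Xᶜ E ∧
    ∀ α : Set (Set T), IsUniformCover Xᶜ α → ∀ n : ℕ,
      (∀ x : T, ∀ S : Finset (Set T), ↑S ⊆ α →
        (∀ U ∈ S, (U ∩ {y : T | (y, x) ∈ E}).Nonempty) → S.card ≤ n + 1) →
      DimLE ↥X ((n : ℤ) - 1) := by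
  have hXd : Dense Xᶜ := interior_eq_empty_iff_dense_compl.mp (hXcl.isNowhereDense_iff.mp hXnd)
  have hρc := continuous_infDist_pt X
  have hh : ∀ t ≤ k, hfun t = remoteDist X t := fun t ht => by rw [hhfun, if_pos ht, remoteDist]
  rcases X.eq_empty_or_nonempty with rfl | hXne
  · refine ⟨⟨fun p hp => (hEdef ▸ hp : _ ∧ _).1, fun ε _ => ⟨univ, by simp, isCompact_univ,
      fun p hp => (hp.2 ⟨mem_univ _, mem_univ _⟩).elim⟩⟩, fun α _ n _ => Or.inl ⟨?_, by omega⟩⟩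
    exact isEmpty_coe_sort.mpr rfl
  have hbdd : BddAbove (range fun z => infDist z X) := (isCompact_range hρc).bddAbove
  have hle : ∀ z, infDist z X ≤ k := fun z => hk ▸ le_ciSup hbdd z
  have hkmax : ∃ z, k ≤ infDist z X := by
    obtain ⟨z, -, hz⟩ := isCompact_univ.exists_isMaxOn (hXne.mono (subset_univ X)) hρc.continuousOn
    have _ : Nonempty T := ⟨z⟩
    exact ⟨z, hk ▸ ciSup_le fun w => hz (mem_univ w)⟩
  have hk0 : 0 < k := by
    have _ : Nonempty T := ⟨hXne.some⟩
    obtain ⟨z, hz⟩ := hXd.nonempty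
    exact ((hXcl.notMem_iff_infDist_pos hXne).mp hz).trans_le (hle z)
  have hid : Tendsto (fun t : ℝ => t) (𝓝[>] 0) (𝓝 0) := tendsto_id.mono_left nhdsWithin_le_nhds
  refine ⟨⟨fun p hp => (hEdef ▸ hp : _ ∧ _).1, fun ε hε => ?_⟩, fun α hα n hmult => ?_⟩
  · have hphi : Tendsto phifun (𝓝[>] 0) (𝓝 0) := by
      have hadd : Tendsto (fun t => t + lam t) (𝓝[>] 0) (𝓝 0) := by
        simpa using hid.add hlam_lim
      have hIoc : ∀ᶠ t in 𝓝[>] (0 : ℝ), t ∈ Ioc 0 k := Ioc_mem_nhdsGT hk0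
      have hadd' : Tendsto (fun t => t + lam t) (𝓝[>] 0) (𝓝[>] 0) :=
        tendsto_nhdsWithin_iff.mpr ⟨hadd, hIoc.mono fun t ht => add_pos ht.1 (hlam_pos t ht)⟩
      have hrem := tendsto_remoteDist hXcl hXd
      have hsum := (hrem.add hlam_lim).add (hrem.comp hadd')
      rw [add_zero, add_zero] at hsum
      refine hsum.congr' ?_
      filter_upwards [hIoc, hadd.eventually (ge_mem_nhds hk0)] with t ht ht'
      rw [hphifun, hh t ht.2, hh _ ht', Function.comp_apply]
    obtain ⟨δ, hδ, hsub⟩ :=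
      mem_nhdsGT_iff_exists_Ioc_subset.mp (hphi.eventually (gt_mem_nhds hε))
    refine ⟨{z | δ ≤ infDist z X}, fun z hz hzX => ?_,
      (isClosed_le continuous_const hρc).isCompact, fun p hp => ?_⟩
    · exact (infDist_zero_of_mem hzX ▸ hz : δ ≤ 0).not_gt hδ
    · obtain ⟨⟨⟨h1, h2⟩, hlt⟩, hpK⟩ : (p ∈ Xᶜ ×ˢ Xᶜ ∧ _) ∧ _ := hEdef ▸ hp
      have hmin : min (infDist p.1 X) (infDist p.2 X) < δ := by
        by_contra! hge
        exact hpK ⟨hge.trans (min_le_left _ _), hge.trans (min_le_right _ _)⟩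
      refine hlt.trans (hsub ⟨lt_min ?_ ?_, hmin.le⟩)
      · exact (hXcl.notMem_iff_infDist_pos hXne).mp h1
      · exact (hXcl.notMem_iff_infDist_pos hXne).mp h2
  · have hcyl : HasFineCylinders X n := by
      refine hα.hasFineCylinders hXcl hXd hXne hk0 hkmax hlam_pos hlam_mono hlam_lim
        (fun y hy z hz t ht htk hlt => ?_) hmult
      rw [hEdef]
      refine ⟨⟨hy, hz⟩, ?_⟩
      dsimp only
      rw [← ht, hphifun, hh t (ht ▸ (min_le_left _ _).trans (hle y)), hh _ htk]
      exact hlt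
    have _ : CompactSpace X := isCompact_iff_compactSpace.mp hXcl.isCompact
    rcases Nat.eq_zero_or_pos n with rfl | hn
    · have hchain : HasPoleChain fun _ : X => (0 : Fin 0 → ℝ) :=
        hcyl.hasPoleChain (by simp) continuous_const
          fun _ => by rw [norm_zero]; exact zero_le_one
      exact (hchain.isEmpty.false ⟨_, hXne.some_mem⟩).elim
    · obtain ⟨m, rfl⟩ : ∃ m, n = m + 1 := ⟨n - 1, by omega⟩
      obtain ⟨V, _, _, hV, hext⟩ := hcyl.hasUnitExtensions hn.ne'
      have _ : FiniteDimensional ℝ V := Module.finite_of_finrank_pos (by omega)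
      simpa using hext.dimLE hV hcyl.hasFinePartitions
end

section
/- Let (X, X̂, X̃) be a metrizable compactification pack, let d be a metric on X̃ inducing its topology, let ℰ₀ be the C₀ coarse structure on X̂, and suppose dim X ≤ n for some n ∈ ℕ. Then for every uniform cover γ of X̂ there exists a canonical cover α of (X, X̂, X̃) with γ ≺ α and mult α ≤ n + 2. -/
open Set Metric Topology Filter

/-- A relatively open subset `V` of a subset `X` of a metric space extends to an open subset of
the whole space: the points that are closer to `V` than to `X \ V`. -/
def openExtension {T : Type*} [MetricSpace T] {X : Set T} (V : Set X) : Set T :=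
  {t | infEDist t (Subtype.val '' V) < infEDist t (Subtype.val '' Vᶜ)}

theorem isOpen_openExtension {T : Type*} [MetricSpace T] {X : Set T} (V : Set X) :
    IsOpen (openExtension V) :=
  isOpen_lt continuous_infEDist continuous_infEDist

theorem mem_openExtension {T : Type*} [MetricSpace T] {X : Set T} (hX : IsClosed X)
    {V : Set X} (hV : IsOpen V) {v : X} (hv : v ∈ V) : (v : T) ∈ openExtension V := by
  have h0 : infEDist (v : T) (Subtype.val '' V) = 0 :=
    infEDist_zero_of_mem (mem_image_of_mem _ hv)
  have hc : IsClosed (Subtype.val '' Vᶜ : Set T) :=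
    hX.isClosedEmbedding_subtypeVal.isClosedMap _ hV.isClosed_compl
  change infEDist (v : T) _ < infEDist (v : T) _
  rw [h0, pos_iff_ne_zero]
  intro h
  have := (mem_iff_infEDist_zero_of_closed hc).2 h
  simp [hv] at this

/-- Finitely many relatively open sets whose extensions have a common point
have a common point themselves. -/
theorem nonempty_sInter_of_mem_openExtension {T : Type*} [MetricSpace T] {X : Set T}
    (S : Finset (Set X)) (hS : S.Nonempty) (t : T) (ht : ∀ V ∈ S, t ∈ openExtension V) :
    (⋂₀ (S : Set (Set X))).Nonempty := by
  obtain ⟨V, hV, hmin⟩ := S.exists_min_image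
    (fun V => infEDist t (Subtype.val '' Vᶜ)) hS
  obtain ⟨_, ⟨v, hv, rfl⟩, hlt⟩ := infEDist_lt_iff.1 (ht V hV)
  refine ⟨v, fun W hW => ?_⟩
  by_contra hvW
  have h1 : infEDist t (Subtype.val '' Wᶜ) ≤ edist t v :=
    infEDist_le_edist_of_mem (mem_image_of_mem _ hvW)
  exact absurd (hlt.trans_le ((hmin W hW).trans h1)) (lt_irrefl _)

/-- If `dim X ≤ n`, a family of open sets of the ambient space covering the compact set `X` has
a finite open refinement that covers `X`, has small mesh, and has multiplicity at most `n + 1`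
in the whole ambient space. -/
theorem DimLE.exists_finset_refinement {T : Type*} [MetricSpace T] [CompactSpace T] {X : Set T}
    (hXcl : IsClosed X) (hXne : X.Nonempty) {n : ℕ} (hdim : DimLE ↥X (n : ℤ))
    (β : Finset (Set T)) (hβo : ∀ U ∈ β, IsOpen U) (hβX : X ⊆ ⋃₀ (β : Set (Set T)))
    {ε : ℝ} (hε : 0 < ε) :
    ∃ β' : Finset (Set T), (∀ U ∈ β', IsOpen U) ∧ X ⊆ ⋃₀ (β' : Set (Set T)) ∧
      MultLE (β' : Set (Set T)) (n + 1) ∧ (∀ V ∈ β', ∃ U ∈ β, V ⊆ U) ∧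
      ∀ V ∈ β', ∀ x ∈ V, ∀ y ∈ V, dist x y < ε := by
  classical
  have : CompactSpace X := isCompact_iff_compactSpace.1 hXcl.isCompact
  have hdim' : ∀ α : Set (Set X), α.Finite → (∀ U ∈ α, IsOpen U) → ⋃₀ α = univ →
      ∃ β : Set (Set X), β.Finite ∧ (∀ V ∈ β, IsOpen V) ∧ ⋃₀ β = univ ∧
        Refines β α ∧ MultLE β (n + 1) := by
    rcases hdim with ⟨h, -⟩ | ⟨m, hm, h⟩
    · exact absurd hXne.to_subtype (not_nonempty_iff.2 h)
    · obtain rfl : m = n := by exact_mod_cast hm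
      exact h
  have hU : ∀ x : X, ∃ U ∈ β, (x : T) ∈ U := fun x => hβX x.2
  choose U hUβ hxU using hU
  obtain ⟨F, hF⟩ := isCompact_univ.elim_finite_subcover
    (fun x : X => (Subtype.val ⁻¹' (U x ∩ ball (x : T) (ε / 2)) : Set X))
    (fun x => ((hβo _ (hUβ x)).inter isOpen_ball).preimage continuous_subtype_val)
    (fun x _ => mem_iUnion.2 ⟨x, hxU x, mem_ball_self (half_pos hε)⟩)
  obtain ⟨δ, hδf, hδo, hδu, hδr, hδm⟩ := hdim'
    ((fun x : X => (Subtype.val ⁻¹' (U x ∩ ball (x : T) (ε / 2)) : Set X)) '' F)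
    (F.finite_toSet.image _)
    (by
      rintro _ ⟨x, -, rfl⟩
      exact ((hβo _ (hUβ x)).inter isOpen_ball).preimage continuous_subtype_val)
    (by
      rw [sUnion_image]
      exact univ_subset_iff.1 hF)
  have hc : ∀ V ∈ δ, ∃ x : X, V ⊆ (Subtype.val ⁻¹' (U x ∩ ball (x : T) (ε / 2)) : Set X) := by
    intro V hV
    obtain ⟨_, ⟨x, -, rfl⟩, h⟩ := hδr V hV
    exact ⟨x, h⟩
  have : Nonempty X := hXne.to_subtype
  choose! c hc using hc
  let g : Set X → Set T := fun V => openExtension V ∩ (U (c V) ∩ ball (c V : T) (ε / 2))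
  refine ⟨hδf.toFinset.image g, ?_, ?_, ?_, ?_, ?_⟩
  · simp only [Finset.mem_image, Finite.mem_toFinset]
    rintro _ ⟨V, -, rfl⟩
    exact (isOpen_openExtension V).inter ((hβo _ (hUβ _)).inter isOpen_ball)
  · intro x hx
    obtain ⟨V, hV, hxV⟩ : (⟨x, hx⟩ : X) ∈ ⋃₀ δ := hδu ▸ mem_univ _
    exact ⟨g V, by simpa using ⟨V, hV, rfl⟩,
      mem_openExtension hXcl (hδo V hV) hxV, hc V hV hxV⟩
  · rintro S hS ⟨t, ht⟩
    have hS' : ∀ W ∈ S, ∃ V ∈ δ, g V = W := fun W hW => by simpa using hS hW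
    choose! v hvδ hgv using hS'
    rcases S.eq_empty_or_nonempty with rfl | hne
    · simp
    have hinj : InjOn v S := fun a ha b hb hab => by rw [← hgv a ha, ← hgv b hb, hab]
    rw [← Finset.card_image_of_injOn hinj]
    refine hδm _ ?_ (nonempty_sInter_of_mem_openExtension _ (hne.image v) t ?_)
    · intro V hV
      obtain ⟨W, hW, rfl⟩ := Finset.mem_image.1 (Finset.mem_coe.1 hV)
      exact hvδ W hW
    · intro V hV
      obtain ⟨W, hW, rfl⟩ := Finset.mem_image.1 hV
      have : t ∈ g (v W) := by rw [hgv W hW]; exact ht W hW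
      exact this.1
  · simp only [Finset.mem_image, Finite.mem_toFinset]
    rintro _ ⟨V, -, rfl⟩
    exact ⟨_, hUβ (c V), fun t ht => ht.2.1⟩
  · simp only [Finset.mem_image, Finite.mem_toFinset]
    rintro _ ⟨V, -, rfl⟩ x hx y hy
    have h1 : dist x (c V) < ε / 2 := hx.2.2
    have h2 : dist y (c V) < ε / 2 := hy.2.2
    linarith [dist_triangle_right x y (c V : T)]

/-- A sequence of finite open covers of `X` of multiplicity at most `n + 1`, each refining the
previous one, starting with three copies of the trivial cover, and with mesh tending to `0`. -/
theorem DimLE.exists_seq_covers {T : Type*} [MetricSpace T] [CompactSpace T] {X : Set T}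
    (hXcl : IsClosed X) (hXne : X.Nonempty) {n : ℕ} (hdim : DimLE ↥X (n : ℤ)) :
    ∃ β : ℕ → Finset (Set T), (∀ k ≤ 2, β k = {univ}) ∧ (∀ k, ∀ U ∈ β k, IsOpen U) ∧
      (∀ k, X ⊆ ⋃₀ (β k : Set (Set T))) ∧ (∀ k, MultLE (β k : Set (Set T)) (n + 1)) ∧
      (∀ k, ∀ V ∈ β (k + 1), ∃ U ∈ β k, V ⊆ U) ∧
      ∀ ε > 0, ∃ K, ∀ k ≥ K, ∀ V ∈ β k, ∀ x ∈ V, ∀ y ∈ V, dist x y < ε := by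
  let P : Finset (Set T) → Prop := fun β => (∀ U ∈ β, IsOpen U) ∧
    X ⊆ ⋃₀ (β : Set (Set T)) ∧ MultLE (β : Set (Set T)) (n + 1)
  have hstep : ∀ (k : ℕ) (β : Finset (Set T)), P β → ∃ β', P β' ∧
      (∀ V ∈ β', ∃ U ∈ β, V ⊆ U) ∧ ∀ V ∈ β', ∀ x ∈ V, ∀ y ∈ V, dist x y < 1 / ((k : ℝ) + 1) := by
    intro k β hβ
    obtain ⟨β', h1, h2, h3, h4, h5⟩ := hdim.exists_finset_refinement hXcl hXne β hβ.1 hβ.2.1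
      (ε := 1 / ((k : ℝ) + 1)) (by positivity)
    exact ⟨β', ⟨h1, h2, h3⟩, h4, h5⟩
  choose! f hf using hstep
  let b : ℕ → Finset (Set T) := fun k => Nat.rec {univ} (fun k β => f k β) k
  have hb : ∀ k, P (b k) := by
    intro k
    induction k with
    | zero =>
      refine ⟨by simp [b], by simp [b], fun S hS _ => ?_⟩
      have : S ⊆ {univ} := by
        intro U hU
        simpa [b] using hS hU
      have := Finset.card_le_card this
      rw [Finset.card_singleton] at this
      omega
    | succ k ih => exact (hf k _ ih).1
  refine ⟨fun k => b (k - 2), fun k hk => ?_, fun k => (hb _).1, fun k => (hb _).2.1,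
    fun k => (hb _).2.2, fun k V hV => ?_, fun ε hε => ?_⟩
  · simp [b, Nat.sub_eq_zero_of_le hk]
  · rcases Nat.lt_or_ge k 2 with hk | hk
    · have h1 : k + 1 - 2 = k - 2 := by omega
      exact ⟨V, by simpa [h1] using hV, subset_rfl⟩
    · have h1 : k + 1 - 2 = k - 2 + 1 := by omega
      have hV' : V ∈ b (k - 2 + 1) := h1 ▸ hV
      exact (hf (k - 2) _ (hb _)).2.1 V hV'
  · obtain ⟨N, hN⟩ := exists_nat_one_div_lt hε
    refine ⟨N + 3, fun k hk V hV x hx y hy => ?_⟩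
    obtain ⟨j, rfl⟩ : ∃ j, k = j + 3 := ⟨k - 3, by omega⟩
    have h2 := (hf j _ (hb _)).2.2 V hV x hx y hy
    refine h2.trans (lt_of_le_of_lt ?_ hN)
    apply one_div_le_one_div_of_le (by positivity)
    have : N ≤ j := by omega
    exact_mod_cast Nat.succ_le_succ this

/-- The members of a uniform family that come close to `X` are small. -/
theorem IsUniformFam.eventually_dist_lt {T : Type*} [MetricSpace T] {X : Set T}
    (hXcl : IsClosed X) (hXne : X.Nonempty) {γ : Set (Set T)} (hγ : IsUniformFam Xᶜ γ)
    {ε : ℝ} (hε : 0 < ε) :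
    ∀ᶠ r in 𝓝[>] (0 : ℝ), ∀ G ∈ γ, ∀ g ∈ G, infDist g X ≤ r → ∀ y ∈ G, dist g y < ε := by
  obtain ⟨K, hKX, hK, hKd⟩ := hγ.2 ε hε
  have hr : ∃ r > 0, ∀ z ∈ K, r ≤ infDist z X := by
    rcases K.eq_empty_or_nonempty with rfl | hne
    · exact ⟨1, one_pos, by simp⟩
    · obtain ⟨z, hz, hmin⟩ := hK.exists_isMinOn hne (continuous_infDist_pt X).continuousOn
      exact ⟨infDist z X, (hXcl.notMem_iff_infDist_pos hXne).1 (hKX hz), fun w hw => hmin hw⟩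
  obtain ⟨r, hr0, hr⟩ := hr
  filter_upwards [Ioo_mem_nhdsGT hr0] with s hs G hG g hg hgs y hy
  refine hKd (g, y) ⟨mem_biUnion hG ⟨hg, hy⟩, fun h => ?_⟩
  linarith [hr g h.1, hs.2]

/-- Members of a uniform family that come close to `X` stay close to `X`. -/
theorem IsUniformFam.eventually_infDist_lt {T : Type*} [MetricSpace T] {X : Set T}
    (hXcl : IsClosed X) (hXne : X.Nonempty) {γ : Set (Set T)} (hγ : IsUniformFam Xᶜ γ)
    {t : ℝ} (ht : 0 < t) :
    ∀ᶠ r in 𝓝[>] (0 : ℝ), ∀ G ∈ γ, ∀ g ∈ G, infDist g X ≤ r → ∀ y ∈ G, infDist y X < t := by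
  filter_upwards [hγ.eventually_dist_lt hXcl hXne (half_pos ht),
    Ioo_mem_nhdsGT (half_pos ht)] with r h hr G hG g hg hgr y hy
  have h1 := h G hG g hg hgr y hy
  have h2 : infDist y X ≤ infDist g X + dist y g := infDist_le_infDist_add_dist
  rw [dist_comm] at h2
  linarith [hr.2]

/-- Members of a uniform family that come close to the compact set `X` are contained in members
of any given open cover of `X`. -/
theorem IsUniformFam.eventually_subset {T : Type*} [MetricSpace T] {X : Set T}
    (hXc : IsCompact X) (hXne : X.Nonempty) {γ : Set (Set T)} (hγ : IsUniformFam Xᶜ γ)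
    {β : Set (Set T)} (hβo : ∀ U ∈ β, IsOpen U) (hβX : X ⊆ ⋃₀ β) :
    ∀ᶠ r in 𝓝[>] (0 : ℝ), ∀ G ∈ γ, ∀ g ∈ G, infDist g X ≤ r → ∃ U ∈ β, G ⊆ U := by
  obtain ⟨δ, hδ, hL⟩ := lebesgue_number_lemma_of_metric_sUnion hXc hβo hβX
  filter_upwards [hγ.eventually_dist_lt hXc.isClosed hXne (half_pos hδ),
    Ioo_mem_nhdsGT (half_pos hδ)] with r h hr G hG g hg hgr
  obtain ⟨x, hx, hgx⟩ := (infDist_lt_iff hXne).1 (hgr.trans_lt hr.2)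
  obtain ⟨U, hU, hxU⟩ := hL x hx
  refine ⟨U, hU, fun y hy => hxU ?_⟩
  have := h G hG g hg hgr y hy
  rw [mem_ball]
  linarith [dist_triangle_left y x g]

/-- The radii at which the cover is changed. -/
theorem IsUniformFam.exists_radii {T : Type*} [MetricSpace T] {X : Set T}
    (hXc : IsCompact X) (hXne : X.Nonempty) {γ : Set (Set T)} (hγ : IsUniformFam Xᶜ γ)
    (β : ℕ → Finset (Set T)) (hβ2 : ∀ k ≤ 2, β k = {univ}) (hβo : ∀ k, ∀ U ∈ β k, IsOpen U)
    (hβX : ∀ k, X ⊆ ⋃₀ (β k : Set (Set T))) {D : ℝ} (hD : 0 < D) :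
    ∃ S : ℕ → ℝ, S 0 = D ∧ StrictAnti S ∧ (∀ p, 0 < S p) ∧ Tendsto S atTop (𝓝 0) ∧
      (∀ p, ∀ G ∈ γ, ∀ g ∈ G, infDist g X ≤ S (p + 1) → ∀ y ∈ G, infDist y X < S p) ∧
      ∀ p, ∀ j ≤ p + 2, ∀ G ∈ γ, ∀ g ∈ G, infDist g X ≤ S p → ∃ U ∈ β j, G ⊆ U := by
  have hstep : ∀ (p : ℕ) (t : ℝ), 0 < t → ∃ r, 0 < r ∧ r < t ∧ r < 1 / ((p : ℝ) + 1) ∧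
      (∀ G ∈ γ, ∀ g ∈ G, infDist g X ≤ r → ∀ y ∈ G, infDist y X < t) ∧
      ∀ j ≤ p + 3, ∀ G ∈ γ, ∀ g ∈ G, infDist g X ≤ r → ∃ U ∈ β j, G ⊆ U := by
    intro p t ht
    have hall : ∀ᶠ r in 𝓝[>] (0 : ℝ), ∀ j ∈ Iic (p + 3), ∀ G ∈ γ, ∀ g ∈ G,
        infDist g X ≤ r → ∃ U ∈ β j, G ⊆ U :=
      (eventually_all_finite (finite_Iic (p + 3))).2 fun j _ =>
        hγ.eventually_subset hXc hXne (hβo j) (hβX j)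
    have hp : 0 < 1 / ((p : ℝ) + 1) := by positivity
    obtain ⟨r, h1, h2, h3, h4⟩ := (hall.and ((hγ.eventually_infDist_lt hXc.isClosed hXne ht).and
      ((eventually_mem_set.2 (Ioo_mem_nhdsGT ht)).and
        (eventually_mem_set.2 (Ioo_mem_nhdsGT hp))))).exists
    exact ⟨r, h3.1, h3.2, h4.2, h2, h1⟩
  choose! f hf using hstep
  let S : ℕ → ℝ := fun p => Nat.rec D (fun p t => f p t) p
  have hpos : ∀ p, 0 < S p := by
    intro p
    induction p with
    | zero => exact hD
    | succ p ih => exact (hf p _ ih).1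
  have hS : ∀ p, S (p + 1) = f p (S p) := fun p => rfl
  refine ⟨S, rfl, strictAnti_nat_of_succ_lt fun p => (hf p _ (hpos p)).2.1, hpos, ?_,
    fun p => (hf p _ (hpos p)).2.2.2.1, fun p => ?_⟩
  · rw [← tendsto_add_atTop_iff_nat 1]
    exact squeeze_zero (fun p => (hpos (p + 1)).le) (fun p => (hf p _ (hpos p)).2.2.1.le)
      tendsto_one_div_add_atTop_nhds_zero_nat
  · cases p with
    | zero =>
      intro j hj G _ _ _ _
      exact ⟨univ, by simp [hβ2 j (by omega)], subset_univ _⟩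
    | succ p => exact (hf p _ (hpos p)).2.2.2.2

/-- Enumeration of a sequence of nonempty finite sets, one after the other: the members of `β k`
get distinct numbers in `[M k, M (k + 1))`. -/
theorem exists_consecutive_enumeration {A : Type*} (β : ℕ → Finset A) (hβ : ∀ k, (β k).Nonempty) :
    ∃ (M : ℕ → ℕ) (e : ℕ → A → ℕ), M 0 = 0 ∧ M 1 = (β 0).card ∧ StrictMono M ∧
      (∀ k, ∀ U ∈ β k, M k ≤ e k U ∧ e k U < M (k + 1)) ∧ ∀ k, InjOn (e k) (β k) := by
  classical
  let i : ℕ → A → ℕ := fun k U => if h : U ∈ β k then ((β k).equivFin ⟨U, h⟩ : ℕ) else 0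
  refine ⟨fun k => ∑ j ∈ Finset.range k, (β j).card,
    fun k U => ∑ j ∈ Finset.range k, (β j).card + i k U, by simp, by simp,
    strictMono_nat_of_lt_succ fun k => ?_, fun k U hU => ⟨Nat.le_add_right _ _, ?_⟩,
    fun k U hU V hV h => ?_⟩
  · rw [Finset.sum_range_succ]
    have := (hβ k).card_pos
    omega
  · simp [Finset.sum_range_succ, i, hU]
  · rw [Finset.mem_coe] at hU hV
    simpa [i, hU, hV, Fin.val_inj] using h

/-- The member of the canonical cover that belongs to the member `U` of `β k`: the union of those
members `V` of `β (k + 1)` with parent `π k V = U`, the set `V` being cut off below the radius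
with number `e (k + 1) V`, and everything being cut off above the radius preceding `e k U`. -/
def telescopeSet {T : Type*} (ρ : T → ℝ) (β : ℕ → Finset (Set T)) (π : ℕ → Set T → Set T)
    (e : ℕ → Set T → ℕ) (S : ℕ → ℝ) (k : ℕ) (U : Set T) : Set T :=
  {x | ρ x < S (e k U - 1) ∧ ∃ V ∈ β (k + 1), π k V = U ∧ x ∈ V ∧ S (e (k + 1) V) < ρ x}

theorem isOpen_telescopeSet {T : Type*} [TopologicalSpace T] {ρ : T → ℝ} (hρ : Continuous ρ)
    {β : ℕ → Finset (Set T)} (hβo : ∀ k, ∀ U ∈ β k, IsOpen U) (π : ℕ → Set T → Set T)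
    (e : ℕ → Set T → ℕ) (S : ℕ → ℝ) (k : ℕ) (U : Set T) :
    IsOpen (telescopeSet ρ β π e S k U) := by
  have : telescopeSet ρ β π e S k U = {x | ρ x < S (e k U - 1)} ∩
      ⋃ V ∈ {V | V ∈ β (k + 1) ∧ π k V = U}, V ∩ {x | S (e (k + 1) V) < ρ x} := by
    ext x
    simp only [telescopeSet, mem_ofPred_eq, mem_inter_iff, mem_iUnion, exists_prop, and_assoc]
  rw [this]
  exact (isOpen_lt hρ continuous_const).inter (isOpen_biUnion fun V hV =>
    (hβo _ V hV.1).inter (isOpen_lt continuous_const hρ))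

theorem telescopeSet_subset {T : Type*} {ρ : T → ℝ} {β : ℕ → Finset (Set T)}
    {π : ℕ → Set T → Set T} (hπ : ∀ k, ∀ V ∈ β (k + 1), π k V ∈ β k ∧ V ⊆ π k V)
    {e : ℕ → Set T → ℕ} {S : ℕ → ℝ} {k : ℕ} {U : Set T} :
    telescopeSet ρ β π e S k U ⊆ U := by
  rintro x ⟨-, V, hV, rfl, hx, -⟩
  exact (hπ k V hV).2 hx

theorem StrictMono.exists_between_nat {M : ℕ → ℕ} (hM : StrictMono M) (h0 : M 0 = 0) (p : ℕ) :
    ∃ k, M k ≤ p ∧ p < M (k + 1) := by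
  classical
  have hex : ∃ k, p < M k := ⟨p + 1, lt_of_lt_of_le p.lt_succ_self (hM.id_le _)⟩
  have hne : Nat.find hex ≠ 0 := fun h => by
    have := Nat.find_spec hex
    rw [h, h0] at this
    omega
  obtain ⟨k, hk⟩ := Nat.exists_eq_succ_of_ne_zero hne
  exact ⟨k, not_lt.1 (Nat.find_min hex (by omega)), by simpa [hk] using Nat.find_spec hex⟩

/-- A point lies in at most `m + 1` of the telescope sets if it lies in at most `m` members of
each of the covers. -/
theorem card_le_of_mem_telescopeSet {T : Type*} {ρ : T → ℝ} {β : ℕ → Finset (Set T)}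
    {π : ℕ → Set T → Set T} (hπ : ∀ k, ∀ V ∈ β (k + 1), π k V ∈ β k ∧ V ⊆ π k V)
    {e : ℕ → Set T → ℕ} {M : ℕ → ℕ} (hM0 : M 0 = 0) (hM : StrictMono M)
    (heM : ∀ k, ∀ U ∈ β k, M k ≤ e k U ∧ e k U < M (k + 1)) (heinj : ∀ k, InjOn (e k) (β k))
    {S : ℕ → ℝ} (hS : StrictAnti S) {m : ℕ} (hmult : ∀ k, MultLE (β k : Set (Set T)) m)
    {x : T} (hx0 : ρ x < S 0) (hxS : ∃ p, S p < ρ x)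
    (I : Finset (ℕ × Set T)) (hI : ∀ i ∈ I, i.2 ∈ β i.1 ∧ x ∈ telescopeSet ρ β π e S i.1 i.2) :
    I.card ≤ m + 1 := by
  classical
  obtain ⟨p, hp, hpmin⟩ : ∃ p, S p < ρ x ∧ ∀ q < p, ρ x ≤ S q :=
    ⟨Nat.find hxS, Nat.find_spec hxS, fun q hq => not_lt.1 (Nat.find_min hxS hq)⟩
  have hp0 : p ≠ 0 := by
    rintro rfl
    exact absurd hp hx0.not_gt
  obtain ⟨k, hkp, hpk⟩ := hM.exists_between_nat hM0 p
  have hIle : ∀ i ∈ I, e i.1 i.2 ≤ p := by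
    intro i hi
    have h1 := (hI i hi).2.1
    have h2 := hS.lt_iff_gt.1 (hp.trans h1)
    omega
  have hchild : ∀ i ∈ I, ∃ V ∈ β (i.1 + 1), π i.1 V = i.2 ∧ x ∈ V ∧ p ≤ e (i.1 + 1) V := by
    intro i hi
    obtain ⟨-, V, hV, hπV, hxV, hlt⟩ := (hI i hi).2
    refine ⟨V, hV, hπV, hxV, ?_⟩
    by_contra! h
    exact absurd hlt (hpmin _ h).not_gt
  choose! c hcβ hcπ hcx hcp using hchild
  have hlev : ∀ i ∈ I, i.1 = k ∨ i.1 + 1 = k := by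
    intro i hi
    have h1 := (heM _ _ (hI i hi).1).1.trans (hIle i hi)
    have h2 := (hcp i hi).trans_lt (heM _ _ (hcβ i hi)).2
    have h3 := hM.lt_iff_lt.1 (h1.trans_lt hpk)
    have h4 := hM.lt_iff_lt.1 (hkp.trans_lt h2)
    omega
  let f : ℕ × Set T → Set T := fun i => if i.1 = k then i.2 else c i
  let J := I.filter fun i => e i.1 i.2 < p
  have hfJ : ∀ i ∈ J, f i ∈ β k ∧ x ∈ f i ∧ (i.1 = k ↔ e k (f i) < p) := by
    intro i hi
    obtain ⟨hiI, hip⟩ := Finset.mem_filter.1 hi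
    by_cases h : i.1 = k
    · subst h
      simp only [f, if_true, true_iff]
      exact ⟨(hI i hiI).1, telescopeSet_subset hπ (hI i hiI).2, hip⟩
    · have h' := (hlev i hiI).resolve_left h
      simp only [f, h, if_false, false_iff, not_lt]
      rw [← h']
      exact ⟨hcβ i hiI, hcx i hiI, hcp i hiI⟩
  have hfinj : InjOn f J := by
    intro i hi j hj hij
    have hiI := (Finset.mem_filter.1 hi).1
    have hjI := (Finset.mem_filter.1 hj).1
    have hk : i.1 = k ↔ j.1 = k := by rw [(hfJ i hi).2.2, (hfJ j hj).2.2, hij]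
    by_cases h : i.1 = k
    · have hj' := hk.1 h
      simp only [f, h, hj', if_true] at hij
      exact Prod.ext (h.trans hj'.symm) hij
    · have hj' : ¬ j.1 = k := fun h' => h (hk.2 h')
      have h1 := (hlev i hiI).resolve_left h
      have h2 := (hlev j hjI).resolve_left hj'
      have h3 : i.1 = j.1 := by omega
      simp only [f, if_neg h, if_neg hj'] at hij
      refine Prod.ext h3 ?_
      rw [← hcπ i hiI, ← hcπ j hjI, hij, h3]
  have hJ : J.card ≤ m := by
    rw [← Finset.card_image_of_injOn hfinj]
    refine hmult k _ ?_ ⟨x, ?_⟩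
    · intro V hV
      obtain ⟨i, hi, rfl⟩ := Finset.mem_image.1 (Finset.mem_coe.1 hV)
      exact (hfJ i hi).1
    · intro V hV
      obtain ⟨i, hi, rfl⟩ := Finset.mem_image.1 (Finset.mem_coe.1 hV)
      exact (hfJ i hi).2.1
  have hrest : (I.filter fun i => ¬ e i.1 i.2 < p).card ≤ 1 := by
    refine Finset.card_le_one.2 fun i hi j hj => ?_
    obtain ⟨hiI, hip⟩ := Finset.mem_filter.1 hi
    obtain ⟨hjI, hjp⟩ := Finset.mem_filter.1 hj
    have h1 : e i.1 i.2 = p := le_antisymm (hIle i hiI) (not_lt.1 hip)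
    have h2 : e j.1 j.2 = p := le_antisymm (hIle j hjI) (not_lt.1 hjp)
    have h3 := heM _ _ (hI i hiI).1
    have h4 := heM _ _ (hI j hjI).1
    have h5 := hM.lt_iff_lt.1 (h3.1.trans_lt (h1.trans_lt (h2.symm.trans_lt h4.2)))
    have h6 := hM.lt_iff_lt.1 (h4.1.trans_lt (h2.trans_lt (h1.symm.trans_lt h3.2)))
    have h7 : i.1 = j.1 := by omega
    refine Prod.ext h7 (heinj i.1 (hI i hiI).1 ?_ (h1.trans ?_))
    · rw [h7]; exact (hI j hjI).1
    · rw [h7, h2]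
  have := Finset.card_filter_add_card_filter_not (s := I) (fun i => e i.1 i.2 < p)
  change J.card + _ = _ at this
  omega

/-- A nonempty set that does not meet two consecutive cut-off radii, and that is contained in
members of the covers as soon as it comes close to `ρ = 0`, is contained in a telescope set. -/
theorem exists_subset_telescopeSet {T : Type*} {ρ : T → ℝ} {β : ℕ → Finset (Set T)}
    {π : ℕ → Set T → Set T} (hπ : ∀ k, ∀ V ∈ β (k + 1), π k V ∈ β k ∧ V ⊆ π k V)
    {e : ℕ → Set T → ℕ} {M : ℕ → ℕ} (hM0 : M 0 = 0) (hM1 : M 1 = 1) (hM : StrictMono M)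
    (heM : ∀ k, ∀ U ∈ β k, M k ≤ e k U ∧ e k U < M (k + 1))
    {S : ℕ → ℝ} (hS : StrictAnti S) {G : Set T} {g : T} (hg : g ∈ G)
    (hG0 : ∀ y ∈ G, ρ y < S 0) (hgS : ∃ p, S p < ρ g)
    (hGS : ∀ p, ∀ g ∈ G, ρ g ≤ S (p + 1) → ∀ y ∈ G, ρ y < S p)
    (hGβ : ∀ p, ∀ j ≤ p + 2, ∀ g ∈ G, ρ g ≤ S p → ∃ U ∈ β j, G ⊆ U) :
    ∃ k, ∃ U ∈ β k, G ⊆ telescopeSet ρ β π e S k U := by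
  classical
  have hex : ∃ p, ∀ y ∈ G, S p < ρ y := by
    obtain ⟨p, hp⟩ := hgS
    refine ⟨p + 1, fun y hy => ?_⟩
    by_contra! h
    exact absurd hp (hGS p y hy h g hg).not_gt
  obtain ⟨p, hp, hpmin⟩ : ∃ p, (∀ y ∈ G, S p < ρ y) ∧ ∀ q < p, ∃ y ∈ G, ρ y ≤ S q := by
    refine ⟨Nat.find hex, Nat.find_spec hex, fun q hq => ?_⟩
    simpa using Nat.find_min hex hq
  have hp0 : p ≠ 0 := by
    rintro rfl
    exact absurd (hp g hg) (hG0 g hg).not_gt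
  have hupper : ∀ q < p, ∀ y ∈ G, ρ y < S (q - 1) := by
    intro q hq y hy
    cases q with
    | zero => exact hG0 y hy
    | succ q =>
      obtain ⟨z, hz, hzS⟩ := hpmin _ hq
      exact hGS q z hz hzS y hy
  obtain ⟨k, hkp, hpk⟩ := hM.exists_between_nat hM0 p
  obtain ⟨z, hz, hzS⟩ := hpmin (p - 1) (by omega)
  have hkle : k ≤ M k := hM.id_le k
  obtain ⟨R, hR, hGR⟩ := hGβ (p - 1) (k + 1) (by omega) z hz hzS
  obtain ⟨hUβ, hRU⟩ := hπ k R hR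
  by_cases hlt : e k (π k R) < p
  · refine ⟨k, π k R, hUβ, fun y hy => ⟨hupper _ hlt y hy, R, hR, rfl, hGR hy, ?_⟩⟩
    exact (hS.antitone (hpk.le.trans (heM _ _ hR).1)).trans_lt (hp y hy)
  · cases k with
    | zero =>
      rw [Nat.zero_add, hM1] at hpk
      omega
    | succ k =>
      obtain ⟨hUβ', -⟩ := hπ k _ hUβ
      have h1 := (heM _ _ hUβ').2
      refine ⟨k, _, hUβ', fun y hy => ⟨hupper _ (h1.trans_le hkp) y hy, _, hUβ, rfl,
        hRU (hGR hy), ?_⟩⟩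
      exact (hS.antitone (not_lt.1 hlt)).trans_lt (hp y hy)

/-- If `dim X ≤ n`, then every uniform cover `γ` of `X̂` is refined
in a canonical cover `α` with `mult α ≤ n + 2`. -/
theorem statement19 {T : Type*} [MetricSpace T] [CompactSpace T]
    (X : Set T) (hXcl : IsClosed X) (hXnd : IsNowhereDense X)
    (n : ℕ) (hdim : DimLE ↥X (n : ℤ))
    (γ : Set (Set T)) (hγ : IsUniformCover Xᶜ γ) :
    ∃ α : Set (Set T), IsCanonicalCover X α ∧ Refines γ α ∧ MultLE α (n + 2) := by
  classical
  rcases X.eq_empty_or_nonempty with rfl | hXne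
  · refine ⟨{univ}, ⟨by simp, by simp, fun x _ => ⟨univ, isOpen_univ, mem_univ x, ?_⟩, by simp⟩,
      fun V _ => ⟨univ, rfl, subset_univ V⟩, fun S hS _ => ?_⟩
    · exact (finite_singleton univ).subset (sep_subset _ _)
    · have := Finset.card_le_card (show S ⊆ {univ} from fun U hU => by simpa using hS hU)
      rw [Finset.card_singleton] at this
      omega
  have hXc : IsCompact X := hXcl.isCompact
  obtain ⟨β, hβ2, hβo, hβX, hβm, hβr, hβd⟩ := hdim.exists_seq_covers hXcl hXne
  choose! π hπ using hβr
  have hβne : ∀ k, (β k).Nonempty := fun k =>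
    let ⟨x, hx⟩ := hXne
    let ⟨U, hU, _⟩ := hβX k hx
    ⟨U, hU⟩
  obtain ⟨M, e, hM0, hM1, hM, heM, heinj⟩ := exists_consecutive_enumeration β hβne
  rw [hβ2 0 (by omega), Finset.card_singleton] at hM1
  have hρ : Continuous fun x : T => infDist x X := continuous_infDist_pt X
  have hρpos : ∀ x, x ∉ X → 0 < infDist x X := fun x =>
    (hXcl.notMem_iff_infDist_pos hXne).1
  obtain ⟨D, hDpos, hD⟩ : ∃ D > 0, ∀ x : T, infDist x X < D := by
    obtain ⟨x₀, hx₀⟩ := hXne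
    refine ⟨diam (univ : Set T) + 1, by positivity, fun x => ?_⟩
    have h1 := infDist_le_dist_of_mem (x := x) hx₀
    have h2 := dist_le_diam_of_mem isCompact_univ.isBounded (mem_univ x) (mem_univ x₀)
    linarith
  obtain ⟨S, hS0, hS, hSpos, hSlim, hSH, hSL⟩ :=
    hγ.1.exists_radii hXc hXne β hβ2 hβo hβX hDpos
  have hSsmall : ∀ r > 0, ∃ p, S p < r := fun r hr => (hSlim.eventually (gt_mem_nhds hr)).exists
  let A : ℕ → Set T → Set T := telescopeSet (fun x => infDist x X) β π e S
  let α : Set (Set T) := {W | ∃ k, ∃ U ∈ β k, A k U = W}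
  have hαX : ∀ W ∈ α, W ⊆ Xᶜ := by
    rintro _ ⟨k, U, -, rfl⟩ x ⟨-, V, -, -, -, hx⟩ hxX
    change _ < infDist x X at hx
    rw [infDist_zero_of_mem hxX] at hx
    exact absurd hx (hSpos _).not_gt
  have hex : ∀ G ∈ γ, ∀ g ∈ G, ∃ k, ∃ U ∈ β k, G ⊆ A k U := by
    intro G hG g hg
    have hgX : g ∉ X := by
      have : g ∈ ⋃₀ γ := ⟨G, hG, hg⟩
      rwa [hγ.2] at this
    exact exists_subset_telescopeSet hπ hM0 hM1 hM heM hS hg (fun y _ => hS0 ▸ hD y)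
      (hSsmall _ (hρpos g hgX)) (fun p => hSH p G hG) (fun p j hj => hSL p j hj G hG)
  refine ⟨α, ⟨?_, ?_, ?_, ?_⟩, ?_, ?_⟩
  · rintro W hW
    refine ⟨?_, hαX W hW⟩
    obtain ⟨k, U, -, rfl⟩ := hW
    exact isOpen_telescopeSet hρ hβo π e S k U
  · refine subset_antisymm (sUnion_subset hαX) fun x hx => ?_
    obtain ⟨G, hG, hxG⟩ : x ∈ ⋃₀ γ := by rwa [hγ.2]
    obtain ⟨k, U, hU, hGU⟩ := hex G hG x hxG
    exact ⟨_, ⟨k, U, hU, rfl⟩, hGU hxG⟩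
  · intro x hx
    obtain ⟨p, hp⟩ := hSsmall _ (hρpos x hx)
    refine ⟨{y | S p < infDist y X}, isOpen_lt continuous_const hρ, hp, ?_⟩
    refine ((finite_Iic (p + 1)).biUnion fun k _ =>
      ((β k).finite_toSet.image (A k))).subset ?_
    rintro _ ⟨⟨k, U, hU, rfl⟩, y, hyA, hy⟩
    refine mem_biUnion (x := k) ?_ ⟨U, hU, rfl⟩
    have h1 := hS.lt_iff_gt.1 (lt_trans hy hyA.1)
    have h2 := (heM k U hU).1
    have h3 : k ≤ M k := hM.id_le k
    change k ≤ p + 1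
    omega
  · intro x hx V hV
    obtain ⟨ε, hε, hεV⟩ := Metric.mem_nhds_iff.1 hV
    obtain ⟨K, hK⟩ := hβd (ε / 2) (half_pos hε)
    have hr : 0 < min (ε / 2) (S (M (K + 1))) := lt_min (half_pos hε) (hSpos _)
    refine ⟨_, ball_mem_nhds x hr, ?_⟩
    rintro y ⟨_, ⟨⟨k, U, hU, rfl⟩, z, hzA, hzx, -⟩, hyA⟩
    apply hεV
    rw [mem_ball, lt_min_iff] at hzx
    have hzS : infDist z X < S (M (K + 1)) := (infDist_le_dist_of_mem hx).trans_lt hzx.2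
    obtain ⟨-, R, hR, -, -, hlt⟩ := id hzA
    have h1 := hS.lt_iff_gt.1 (hlt.trans hzS)
    have h2 := hM.lt_iff_lt.1 (h1.trans (heM _ _ hR).2)
    have h3 := hK k (by omega) U hU y (telescopeSet_subset hπ hyA) z (telescopeSet_subset hπ hzA)
    rw [mem_ball]
    linarith [dist_triangle y z x]
  · intro G hG
    rcases G.eq_empty_or_nonempty with rfl | ⟨g, hg⟩
    · obtain ⟨U, hU⟩ := hβne 0
      exact ⟨_, ⟨0, U, hU, rfl⟩, empty_subset _⟩
    · obtain ⟨k, U, hU, hGU⟩ := hex G hG g hg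
      exact ⟨_, ⟨k, U, hU, rfl⟩, hGU⟩
  · rintro F hF ⟨x, hx⟩
    rcases F.eq_empty_or_nonempty with rfl | ⟨W, hW⟩
    · simp
    have hxX : x ∉ X := hαX W (hF hW) (hx W hW)
    have hF' : ∀ W ∈ F, ∃ i : ℕ × Set T, i.2 ∈ β i.1 ∧ A i.1 i.2 = W := fun W hW => by
      obtain ⟨k, U, hU, h⟩ := hF hW
      exact ⟨(k, U), hU, h⟩
    choose! i hiβ hiA using hF'
    have hinj : InjOn i F := fun a ha b hb hab => by rw [← hiA a ha, ← hiA b hb, hab]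
    rw [← Finset.card_image_of_injOn hinj]
    refine card_le_of_mem_telescopeSet (ρ := fun x => infDist x X) hπ hM0 hM heM heinj hS hβm
      (hS0 ▸ hD x) (hSsmall _ (hρpos x hxX)) _ fun j hj => ?_
    obtain ⟨W, hW, rfl⟩ := Finset.mem_image.1 hj
    refine ⟨hiβ W hW, ?_⟩
    have := hx W hW
    rwa [← hiA W hW] at this
end
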